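/- arXiv:1310.6617 — 2 statements merged into one kernel-verified Lean document; each statement's English description precedes it below -/
import Mathlib

section
/- Let L be a saturated sublattice of rank m of a lattice M of rank n, and let P_1, ..., P_n be convex bodies (compact convex sets) in M tensor R such that P_i is contained in L tensor R for i = 1, ..., m. Then the mixed volume MV_M(P_1, ..., P_n) equals MV_L(P_1, ..., P_m) times MV_{M/L}(pi(P_{m+1}), ..., pi(P_n)), where pi is the projection M tensor R -> (M tensor R)/(L tensor R). -/
open Pointwise MeasureTheory

/-- The mixed volume of a family of compact bodies `Q i ⊆ ℝ^k`, indexed by a finite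
type `ι` (of cardinality `k`), given by the inclusion-exclusion formula
`MV(Q_1,…,Q_k) = ∑_{∅ ≠ s ⊆ ι} (-1)^{k - #s} vol(∑_{i ∈ s} Q i)`,
with the convention `MV = 1` when `k = 0`.  For `k = n` and Lebesgue measure this is
the mixed volume normalized so that the lattice `ℤ^k` has covolume 1. -/
noncomputable def mixedVolume (k : ℕ) {ι : Type*} [Fintype ι]
    (Q : ι → Set (Fin k → ℝ)) : ℝ :=
  if k = 0 then 1 else
    ∑ s ∈ (Finset.univ : Finset ι).powerset,
      if s.Nonempty then
        (-1 : ℝ) ^ (Fintype.card ι - s.card) * (volume (∑ i ∈ s, Q i)).toReal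
      else 0

/-- The coordinatewise cast `ℤ^n → ℝ^n`. -/
def castR (n : ℕ) (x : Fin n → ℤ) : Fin n → ℝ := fun j => (x j : ℝ)

section LogSumExp

variable {κ : Type*} [Fintype κ]

/-- The partition function `∑ p ∈ A, exp ⟨p, x⟩`. -/
noncomputable def expSum (A : Finset (κ → ℝ)) (x : κ → ℝ) : ℝ :=
  ∑ p ∈ A, Real.exp (p ⬝ᵥ x)

/-- The Gibbs weight of `p` at `x`. -/
noncomputable def gibbsWeight (A : Finset (κ → ℝ)) (x p : κ → ℝ) : ℝ :=
  Real.exp (p ⬝ᵥ x) / expSum A x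

/-- The gradient of `log (expSum A)`: the barycenter of `A` for the Gibbs weights. -/
noncomputable def gibbsMean (A : Finset (κ → ℝ)) (x : κ → ℝ) : κ → ℝ :=
  ∑ p ∈ A, gibbsWeight A x p • p

/-- The Hessian of `log (expSum A)`: the covariance matrix of `A` for the Gibbs weights. -/
noncomputable def gibbsCov (A : Finset (κ → ℝ)) (x : κ → ℝ) : Matrix κ κ ℝ :=
  ∑ p ∈ A, gibbsWeight A x p • Matrix.vecMulVec (p - gibbsMean A x) (p - gibbsMean A x)

variable {A : Finset (κ → ℝ)}

lemma expSum_pos (hA : A.Nonempty) (x : κ → ℝ) : 0 < expSum A x :=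
  Finset.sum_pos (fun _ _ => Real.exp_pos _) hA

lemma gibbsWeight_pos (hA : A.Nonempty) (x p : κ → ℝ) : 0 < gibbsWeight A x p :=
  div_pos (Real.exp_pos _) (expSum_pos hA x)

lemma sum_gibbsWeight (hA : A.Nonempty) (x : κ → ℝ) : ∑ p ∈ A, gibbsWeight A x p = 1 := by
  simp only [gibbsWeight, ← Finset.sum_div]
  exact div_self (expSum_pos hA x).ne'

lemma gibbsMean_mem_convexHull (hA : A.Nonempty) (x : κ → ℝ) :
    gibbsMean A x ∈ convexHull ℝ (A : Set (κ → ℝ)) :=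
  (convex_convexHull ℝ _).sum_mem (fun p _ => (gibbsWeight_pos hA x p).le)
    (sum_gibbsWeight hA x) (fun _ hp => subset_convexHull ℝ _ hp)

lemma posSemidef_gibbsCov (hA : A.Nonempty) (x : κ → ℝ) : (gibbsCov A x).PosSemidef := by
  refine Matrix.posSemidef_sum _ fun p _ => ?_
  have h := Matrix.posSemidef_vecMulVec_self_star (p - gibbsMean A x)
  rw [star_trivial] at h
  exact h.smul (gibbsWeight_pos hA x p).le

/-- The linear form `⟨p, ·⟩` as a continuous linear map. -/
noncomputable def dotCLM (p : κ → ℝ) : (κ → ℝ) →L[ℝ] ℝ :=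
  LinearMap.toContinuousLinearMap (dotProductBilin ℝ ℝ p)

lemma dotCLM_apply (p x : κ → ℝ) : dotCLM p x = p ⬝ᵥ x := rfl

lemma hasFDerivAt_exp_dotProduct (p x : κ → ℝ) :
    HasFDerivAt (fun y => Real.exp (p ⬝ᵥ y)) (Real.exp (p ⬝ᵥ x) • dotCLM p) x :=
  ((dotCLM p).hasFDerivAt (x := x)).exp

lemma hasFDerivAt_expSum (A : Finset (κ → ℝ)) (x : κ → ℝ) :
    HasFDerivAt (expSum A) (∑ p ∈ A, Real.exp (p ⬝ᵥ x) • dotCLM p) x := by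
  exact HasFDerivAt.fun_sum fun p _ => hasFDerivAt_exp_dotProduct p x

lemma hasFDerivAt_log_expSum (hA : A.Nonempty) (x : κ → ℝ) :
    HasFDerivAt (fun y => Real.log (expSum A y)) (dotCLM (gibbsMean A x)) x := by
  refine ((hasFDerivAt_expSum A x).log (expSum_pos hA x).ne').congr_fderiv ?_
  ext1 v
  simp only [dotCLM_apply, gibbsMean, sum_dotProduct, smul_dotProduct, gibbsWeight,
    _root_.smul_apply, _root_.sum_apply, smul_eq_mul, Finset.mul_sum]
  exact Finset.sum_congr rfl fun p _ => by ring

lemma gibbsCov_mulVec (hA : A.Nonempty) (x v : κ → ℝ) :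
    (gibbsCov A x).mulVec v =
      ∑ p ∈ A, (gibbsWeight A x p * (p ⬝ᵥ v)) • p - (gibbsMean A x ⬝ᵥ v) • gibbsMean A x := by
  have h1 := sum_gibbsWeight hA x
  have h2 : gibbsMean A x ⬝ᵥ v = ∑ p ∈ A, gibbsWeight A x p * (p ⬝ᵥ v) := by
    simp [gibbsMean, sum_dotProduct]
  have h3 : ∑ p ∈ A, gibbsWeight A x p • p = gibbsMean A x := rfl
  have h4 : (gibbsCov A x).mulVec v = ∑ p ∈ A, (gibbsWeight A x p *
      ((p - gibbsMean A x) ⬝ᵥ v)) • (p - gibbsMean A x) := by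
    simp only [gibbsCov, Matrix.sum_mulVec, Matrix.smul_mulVec, Matrix.vecMulVec_mulVec, mul_smul,
      op_smul_eq_smul]
  rw [h4]
  generalize gibbsMean A x = g at *
  simp only [sub_dotProduct, smul_sub, mul_sub, sub_smul, Finset.sum_sub_distrib,
    ← Finset.sum_smul, ← h2, ← Finset.sum_mul, h1]
  have : ∑ p ∈ A, (gibbsWeight A x p * (g ⬝ᵥ v)) • p = (g ⬝ᵥ v) • g := by
    rw [← h3, Finset.smul_sum]
    exact Finset.sum_congr rfl fun p _ => by rw [h3, smul_smul, mul_comm]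
  rw [this]
  simp

lemma hasFDerivAt_gibbsMean [DecidableEq κ] (hA : A.Nonempty) (x : κ → ℝ) :
    HasFDerivAt (gibbsMean A) (Matrix.toLin' (gibbsCov A x)).toContinuousLinearMap x := by
  have hZ := (expSum_pos hA x).ne'
  have h : HasFDerivAt (fun y => (expSum A y)⁻¹ • ∑ p ∈ A, Real.exp (p ⬝ᵥ y) • p) _ x :=
    ((hasDerivAt_inv hZ).comp_hasFDerivAt x (hasFDerivAt_expSum A x)).fun_smul
    (HasFDerivAt.fun_sum fun p (_ : p ∈ A) => (hasFDerivAt_exp_dotProduct p x).smul_const p)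
  have he : gibbsMean A = fun y => (expSum A y)⁻¹ • ∑ p ∈ A, Real.exp (p ⬝ᵥ y) • p := by
    ext1 y
    simp [gibbsMean, gibbsWeight, Finset.smul_sum, smul_smul, div_eq_inv_mul]
  rw [he]
  refine h.congr_fderiv ?_
  ext1 v
  have hw : ∀ p, Real.exp (p ⬝ᵥ x) = expSum A x * gibbsWeight A x p := fun p => by
    rw [gibbsWeight]; field_simp
  have h2 : gibbsMean A x ⬝ᵥ v = ∑ p ∈ A, gibbsWeight A x p * (p ⬝ᵥ v) := by
    simp [gibbsMean, sum_dotProduct]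
  have h3 : ∑ p ∈ A, gibbsWeight A x p • p = gibbsMean A x := rfl
  simp only [LinearMap.coe_toContinuousLinearMap', Matrix.toLin'_apply, gibbsCov_mulVec hA,
    _root_.add_apply, _root_.smul_apply, _root_.sum_apply,
    ContinuousLinearMap.smulRight_apply, dotCLM_apply, hw, smul_eq_mul]
  have e1 : ∑ p ∈ A, (expSum A x * gibbsWeight A x p * p ⬝ᵥ v) • p =
      expSum A x • ∑ p ∈ A, (gibbsWeight A x p * p ⬝ᵥ v) • p := by
    simp only [Finset.smul_sum, smul_smul, mul_assoc]
  have e2 : ∑ p ∈ A, expSum A x * gibbsWeight A x p * p ⬝ᵥ v =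
      expSum A x * gibbsMean A x ⬝ᵥ v := by
    simp only [h2, Finset.mul_sum, mul_assoc]
  have e3 : ∑ p ∈ A, (expSum A x * gibbsWeight A x p) • p = expSum A x • gibbsMean A x := by
    simp only [← h3, Finset.smul_sum, smul_smul]
  rw [e1, e2, e3, Function.comp_apply, smul_smul, smul_smul, inv_mul_cancel₀ hZ, one_smul,
    sub_eq_add_neg, ← neg_smul]
  congr 2
  field_simp

lemma dotProduct_gibbsMean_sub_pos (hA : A.Nonempty) {x y : κ → ℝ}
    (h : ∃ p ∈ A, ∃ q ∈ A, p ⬝ᵥ (x - y) ≠ q ⬝ᵥ (x - y)) :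
    0 < (gibbsMean A x - gibbsMean A y) ⬝ᵥ (x - y) := by
  have hx := expSum_pos hA x
  have hy := expSum_pos hA y
  have key : (gibbsMean A x - gibbsMean A y) ⬝ᵥ (x - y) = (2 * expSum A x * expSum A y)⁻¹ *
      ∑ p ∈ A, ∑ q ∈ A, Real.exp (p ⬝ᵥ y) * Real.exp (q ⬝ᵥ y) *
        ((p ⬝ᵥ (x - y) - q ⬝ᵥ (x - y)) *
          (Real.exp (p ⬝ᵥ (x - y)) - Real.exp (q ⬝ᵥ (x - y)))) := by
    have e : ∀ p, Real.exp (p ⬝ᵥ x) = Real.exp (p ⬝ᵥ y) * Real.exp (p ⬝ᵥ (x - y)) := fun p => by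
      rw [← Real.exp_add, dotProduct_sub]; ring_nf
    have e2 : ∑ p ∈ A, ∑ q ∈ A, Real.exp (p ⬝ᵥ y) * Real.exp (q ⬝ᵥ y) *
        ((p ⬝ᵥ (x - y) - q ⬝ᵥ (x - y)) *
          (Real.exp (p ⬝ᵥ (x - y)) - Real.exp (q ⬝ᵥ (x - y)))) =
        2 * ((∑ p ∈ A, Real.exp (p ⬝ᵥ x) * (p ⬝ᵥ (x - y))) * expSum A y -
          (∑ p ∈ A, Real.exp (p ⬝ᵥ y) * (p ⬝ᵥ (x - y))) * expSum A x) := by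
      have c : ∀ f g : (κ → ℝ) → ℝ, ∑ p ∈ A, ∑ q ∈ A, f p * g q =
          (∑ p ∈ A, f p) * ∑ q ∈ A, g q := fun f g => by rw [Finset.sum_mul_sum]
      calc _ = (∑ p ∈ A, ∑ q ∈ A, (Real.exp (p ⬝ᵥ x) * (p ⬝ᵥ (x - y))) * Real.exp (q ⬝ᵥ y))
            + (∑ p ∈ A, ∑ q ∈ A, Real.exp (p ⬝ᵥ y) * (Real.exp (q ⬝ᵥ x) * (q ⬝ᵥ (x - y))))
            - (∑ p ∈ A, ∑ q ∈ A, (Real.exp (p ⬝ᵥ y) * (p ⬝ᵥ (x - y))) * Real.exp (q ⬝ᵥ x))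
            - (∑ p ∈ A, ∑ q ∈ A, Real.exp (p ⬝ᵥ x) * (Real.exp (q ⬝ᵥ y) * (q ⬝ᵥ (x - y)))) := by
              simp only [← Finset.sum_add_distrib, ← Finset.sum_sub_distrib]
              refine Finset.sum_congr rfl fun p _ => Finset.sum_congr rfl fun q _ => ?_
              rw [e p, e q]; ring
        _ = _ := by
              simp only [c]
              simp only [expSum]
              ring
    rw [e2]
    simp only [sub_dotProduct, gibbsMean, gibbsWeight, sum_dotProduct, smul_dotProduct, smul_eq_mul,
      div_eq_inv_mul, mul_assoc, ← Finset.mul_sum]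
    field_simp
  rw [key]
  have mono : ∀ a b : ℝ, 0 ≤ (a - b) * (Real.exp a - Real.exp b) := fun a b => by
    rcases le_total a b with h | h
    · exact mul_nonneg_of_nonpos_of_nonpos (sub_nonpos.2 h) (sub_nonpos.2 (Real.exp_le_exp.2 h))
    · exact mul_nonneg (sub_nonneg.2 h) (sub_nonneg.2 (Real.exp_le_exp.2 h))
  have nn : ∀ p q : κ → ℝ, 0 ≤ Real.exp (p ⬝ᵥ y) * Real.exp (q ⬝ᵥ y) *
        ((p ⬝ᵥ (x - y) - q ⬝ᵥ (x - y)) *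
          (Real.exp (p ⬝ᵥ (x - y)) - Real.exp (q ⬝ᵥ (x - y)))) := fun p q =>
    mul_nonneg (by positivity) (mono _ _)
  refine mul_pos (by positivity) ?_
  obtain ⟨p, hp, q, hq, hpq⟩ := h
  refine Finset.sum_pos' (fun p _ => Finset.sum_nonneg fun q _ => nn p q) ⟨p, hp, ?_⟩
  refine Finset.sum_pos' (fun q _ => nn p q) ⟨q, hq, (nn p q).lt_of_ne' ?_⟩
  refine mul_ne_zero (by positivity) (mul_ne_zero (sub_ne_zero.2 hpq) ?_)
  rw [sub_ne_zero]
  exact fun h => hpq (Real.exp_injective h)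

lemma dotProduct_le_log_expSum {x q : κ → ℝ} (hq : q ∈ convexHull ℝ (A : Set (κ → ℝ))) :
    q ⬝ᵥ x ≤ Real.log (expSum A x) := by
  have hA : A.Nonempty := by
    simpa using (convexHull_nonempty_iff (𝕜 := ℝ)).1 ⟨q, hq⟩
  have hc : Convex ℝ {q : κ → ℝ | q ⬝ᵥ x ≤ Real.log (expSum A x)} := by
    refine convex_halfSpace_le (f := fun q => q ⬝ᵥ x)
      ⟨fun a b => add_dotProduct _ _ _, fun a b => smul_dotProduct _ _ _⟩ _
  refine convexHull_min (fun p hp => ?_) hc hq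
  simp only [Set.mem_ofPred_eq]
  rw [Real.le_log_iff_exp_le (expSum_pos hA x)]
  exact Finset.single_le_sum (f := fun p => Real.exp (p ⬝ᵥ x)) (fun _ _ => (Real.exp_pos _).le) hp

end LogSumExp

section MinkowskiSum

variable {κ ι : Type*} [Fintype κ]

lemma exists_dotProduct_ne_of_interior_nonempty {A : Finset (κ → ℝ)}
    (hA : (interior (convexHull ℝ (A : Set (κ → ℝ)))).Nonempty) {d : κ → ℝ} (hd : d ≠ 0) :
    ∃ p ∈ A, ∃ q ∈ A, p ⬝ᵥ d ≠ q ⬝ᵥ d := by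
  by_contra! h
  obtain ⟨x, hx⟩ := hA
  obtain ⟨p₀, hp₀⟩ : A.Nonempty := by
    simpa using (convexHull_nonempty_iff (𝕜 := ℝ)).1 ⟨x, interior_subset hx⟩
  have hlin : IsLinearMap ℝ fun q : κ → ℝ => q ⬝ᵥ d :=
    ⟨fun a b => add_dotProduct _ _ _, fun a b => smul_dotProduct _ _ _⟩
  have hsub : convexHull ℝ (A : Set (κ → ℝ)) ⊆ {q | q ⬝ᵥ d = p₀ ⬝ᵥ d} :=
    convexHull_min (fun p hp => h p hp p₀ hp₀) (convex_hyperplane hlin _)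
  have hcont : Filter.Tendsto (fun t : ℝ => x + t • d) (nhdsWithin 0 {0}ᶜ) (nhds x) := by
    have : Continuous fun t : ℝ => x + t • d := by fun_prop
    simpa using (this.tendsto 0).mono_left nhdsWithin_le_nhds
  obtain ⟨t, ht, ht0⟩ := ((hcont.eventually (isOpen_interior.mem_nhds hx)).and
    self_mem_nhdsWithin).exists
  have h1 := hsub (interior_subset hx)
  have h2 := hsub (interior_subset ht)
  simp only [Set.mem_ofPred_eq, add_dotProduct, smul_dotProduct, smul_eq_mul] at h1 h2
  rw [h1] at h2
  have h3 : t * d ⬝ᵥ d = 0 := by linarith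
  rcases mul_eq_zero.1 h3 with h4 | h4
  · exact ht0 h4
  · exact hd (dotProduct_self_eq_zero.1 h4)

variable {A : ι → Finset (κ → ℝ)} {a : Finset ι}

lemma convex_finsetSum {E : Type*} [AddCommGroup E] [Module ℝ E] {K : ι → Set E} (s : Finset ι)
    (hK : ∀ i ∈ s, Convex ℝ (K i)) : Convex ℝ (∑ i ∈ s, K i) := by
  classical
  induction s using Finset.induction_on with
  | empty => simpa using convex_zero
  | insert i s hi ih =>
    rw [Finset.sum_insert hi]
    exact (hK i (by simp)).add (ih fun j hj => hK j (by simp [hj]))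

lemma isCompact_finsetSum {E : Type*} [AddCommGroup E] [TopologicalSpace E]
    [IsTopologicalAddGroup E] {K : ι → Set E} (s : Finset ι)
    (hK : ∀ i ∈ s, IsCompact (K i)) : IsCompact (∑ i ∈ s, K i) := by
  classical
  induction s using Finset.induction_on with
  | empty => simp
  | insert i s hi ih =>
    rw [Finset.sum_insert hi]
    exact (hK i (by simp)).add (ih fun j hj => hK j (by simp [hj]))

lemma dotProduct_le_sum_log_expSum {x q : κ → ℝ}
    (hq : q ∈ ∑ i ∈ a, convexHull ℝ (A i : Set (κ → ℝ))) :
    q ⬝ᵥ x ≤ ∑ i ∈ a, Real.log (expSum (A i) x) := by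
  obtain ⟨g, hg, rfl⟩ := Set.mem_finsetSum _ _ _ |>.1 hq
  rw [sum_dotProduct]
  exact Finset.sum_le_sum fun i hi => dotProduct_le_log_expSum (hg hi)

/-- Every interior point of a Minkowski sum of polytopes is a sum of Gibbs means. -/
lemma interior_sum_convexHull_subset_range [DecidableEq κ] (hA : ∀ i ∈ a, (A i).Nonempty) :
    interior (∑ i ∈ a, convexHull ℝ (A i : Set (κ → ℝ))) ⊆
      Set.range fun x => ∑ i ∈ a, gibbsMean (A i) x := by
  intro q hq
  obtain ⟨ε, hε, hball⟩ := Metric.nhds_basis_closedBall.mem_iff.1 (mem_interior_iff_mem_nhds.1 hq)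
  set f : (κ → ℝ) → ℝ := fun x => ∑ i ∈ a, Real.log (expSum (A i) x) - q ⬝ᵥ x with hf
  have hder : ∀ x, HasFDerivAt f (dotCLM (∑ i ∈ a, gibbsMean (A i) x - q)) x := by
    intro x
    refine ((HasFDerivAt.fun_sum fun i hi => hasFDerivAt_log_expSum (hA i hi) x).sub
      (dotCLM q).hasFDerivAt).congr_fderiv ?_
    ext1 v
    simp [dotCLM_apply, sum_dotProduct, sub_dotProduct]
  have hbound : ∀ x, ε * ‖x‖ ≤ f x := by
    intro x
    have hs : ∀ (k : κ) (s : ℝ), |s| = ε → s * x k ≤ f x := by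
      intro k s hs
      have hmem : q + s • Pi.single k (1 : ℝ) ∈ Metric.closedBall q ε := by
        rw [Metric.mem_closedBall, dist_eq_norm, add_sub_cancel_left, norm_smul, Real.norm_eq_abs,
          hs]
        simp [Pi.norm_single]
      have := dotProduct_le_sum_log_expSum (x := x) (hball hmem)
      rw [add_dotProduct, smul_dotProduct, single_one_dotProduct, smul_eq_mul] at this
      simp only [hf]
      linarith
    have hf0 : 0 ≤ f x := by
      have := dotProduct_le_sum_log_expSum (x := x) (interior_subset hq)
      simp only [hf]
      linarith
    have : ‖x‖ ≤ f x / ε := by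
      refine (pi_norm_le_iff_of_nonneg (by positivity)).2 fun k => ?_
      rw [Real.norm_eq_abs, le_div_iff₀ hε]
      rcases abs_cases (x k) with h | h
      · rw [h.1, mul_comm]; exact hs k ε (abs_of_pos hε)
      · rw [h.1]
        have := hs k (-ε) (by rw [abs_neg, abs_of_pos hε])
        linarith
    rwa [le_div_iff₀ hε, mul_comm] at this
  have hcont : Continuous f := continuous_iff_continuousAt.2 fun x => (hder x).continuousAt
  have htend : Filter.Tendsto f (Filter.cocompact _) Filter.atTop :=
    Filter.tendsto_atTop_mono hbound ((tendsto_norm_cocompact_atTop).const_mul_atTop hε)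
  obtain ⟨x, hx⟩ := hcont.exists_forall_le htend
  have h0 := IsLocalMin.hasFDerivAt_eq_zero (Filter.Eventually.of_forall hx) (hder x)
  refine ⟨x, sub_eq_zero.1 ((dotProduct_self_eq_zero).1 ?_)⟩
  exact congrArg (fun T : (κ → ℝ) →L[ℝ] ℝ => T (∑ i ∈ a, gibbsMean (A i) x - q)) h0

lemma injective_sum_gibbsMean (ha : a.Nonempty)
    (hA : ∀ i ∈ a, (interior (convexHull ℝ (A i : Set (κ → ℝ)))).Nonempty) :
    Function.Injective fun x => ∑ i ∈ a, gibbsMean (A i) x := by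
  intro x y hxy
  by_contra hne
  have hpos : 0 < (∑ i ∈ a, gibbsMean (A i) x - ∑ i ∈ a, gibbsMean (A i) y) ⬝ᵥ (x - y) := by
    rw [← Finset.sum_sub_distrib, sum_dotProduct]
    refine Finset.sum_pos (fun i hi => ?_) ha
    have hi' := hA i hi
    refine dotProduct_gibbsMean_sub_pos ?_
      (exists_dotProduct_ne_of_interior_nonempty hi' (sub_ne_zero.2 hne))
    simpa using (convexHull_nonempty_iff (𝕜 := ℝ)).1 (hi'.mono interior_subset)
  simp only at hxy
  rw [hxy, sub_self, zero_dotProduct] at hpos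
  exact hpos.false

/-- The volume of a Minkowski sum of full-dimensional polytopes is the integral of the determinant
of the sum of their Gibbs covariance matrices. -/
lemma hasIntegral_det_sum_gibbsCov [DecidableEq κ] (ha : a.Nonempty)
    (hA : ∀ i ∈ a, (interior (convexHull ℝ (A i : Set (κ → ℝ)))).Nonempty) :
    Integrable (fun x => (∑ i ∈ a, gibbsCov (A i) x).det) ∧
    ∫ x, (∑ i ∈ a, gibbsCov (A i) x).det =
      (volume (∑ i ∈ a, convexHull ℝ (A i : Set (κ → ℝ)))).toReal := by
  have hne : ∀ i ∈ a, (A i).Nonempty := fun i hi => by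
    simpa using (convexHull_nonempty_iff (𝕜 := ℝ)).1 ((hA i hi).mono interior_subset)
  set K := ∑ i ∈ a, convexHull ℝ (A i : Set (κ → ℝ)) with hK
  set G : (κ → ℝ) → κ → ℝ := fun x => ∑ i ∈ a, gibbsMean (A i) x with hG
  have hder : ∀ x ∈ Set.univ, HasFDerivWithinAt G
      (Matrix.toLin' (∑ i ∈ a, gibbsCov (A i) x)).toContinuousLinearMap Set.univ x := by
    intro x _
    refine ((HasFDerivAt.fun_sum fun i hi =>
      hasFDerivAt_gibbsMean (hne i hi) x).congr_fderiv ?_).hasFDerivWithinAt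
    simp
  have hdet : ∀ x, |(LinearMap.toContinuousLinearMap
      (Matrix.toLin' (∑ i ∈ a, gibbsCov (A i) x))).det| = (∑ i ∈ a, gibbsCov (A i) x).det := by
    intro x
    rw [LinearMap.det_toContinuousLinearMap, LinearMap.det_toLin', abs_of_nonneg]
    exact (Matrix.posSemidef_sum _ fun i hi => posSemidef_gibbsCov (hne i hi) x).det_nonneg
  have hinj : Set.InjOn G Set.univ := (injective_sum_gibbsMean ha hA).injOn
  have hconv : Convex ℝ K := convex_finsetSum _ fun i _ => convex_convexHull ℝ _
  have hcpt : IsCompact K := isCompact_finsetSum _ fun i _ =>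
    (A i).finite_toSet.isCompact_convexHull (𝕜 := ℝ)
  have hlow : interior K ⊆ G '' Set.univ := by
    rw [Set.image_univ]; exact interior_sum_convexHull_subset_range hne
  have hup : G '' Set.univ ⊆ K := by
    rintro _ ⟨x, -, rfl⟩
    exact Set.finsetSum_mem_finsetSum _ _ _ fun i hi => gibbsMean_mem_convexHull (hne i hi) x
  have hvint : volume (interior K) = volume K :=
    measure_interior_of_null_frontier (hconv.addHaar_frontier volume)
  have hvol : volume (G '' Set.univ) = volume K :=
    le_antisymm (measure_mono hup) (hvint ▸ measure_mono hlow)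
  have h1 := integrableOn_image_iff_integrableOn_abs_det_fderiv_smul volume MeasurableSet.univ hder
    hinj (fun _ => (1 : ℝ))
  have h2 := integral_image_eq_integral_abs_det_fderiv_smul volume MeasurableSet.univ hder
    hinj (fun _ => (1 : ℝ))
  simp only [hdet, smul_eq_mul, mul_one, integrableOn_univ, setIntegral_univ] at h1 h2
  refine ⟨h1.1 (integrableOn_const ?_), ?_⟩
  · rw [hvol]; exact hcpt.measure_ne_top
  · rw [← h2, setIntegral_const, smul_eq_mul, mul_one, Measure.real, hvol]

end MinkowskiSum

section Polarization

variable {κ ι : Type*} [Fintype κ] [DecidableEq κ] [Fintype ι]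

/-- The alternating sum of a function on finite sets that ignores a given element is zero. -/
lemma sum_neg_one_pow_card_mul_eq_zero [DecidableEq ι] (i₀ : ι) (f : Finset ι → ℝ)
    (hf : ∀ a, i₀ ∉ a → f (insert i₀ a) = f a) :
    ∑ a : Finset ι, (-1 : ℝ) ^ a.card * f a = 0 := by
  rw [← Finset.powerset_univ, ← Finset.insert_erase (Finset.mem_univ i₀),
    Finset.sum_powerset_insert (Finset.notMem_erase _ _), ← Finset.sum_add_distrib]
  refine Finset.sum_eq_zero fun a ha => ?_
  have hi : i₀ ∉ a := fun h => Finset.notMem_erase i₀ _ (Finset.mem_powerset.1 ha h)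
  rw [hf a hi, Finset.card_insert_of_notMem hi]
  ring

/-- Differences of order larger than the size of the matrices annihilate the determinant. -/
lemma sum_neg_one_pow_card_mul_det_eq_zero (hcard : Fintype.card κ < Fintype.card ι)
    (H : ι → Matrix κ κ ℝ) :
    ∑ a : Finset ι, (-1 : ℝ) ^ a.card * (∑ i ∈ a, H i).det = 0 := by
  classical
  have hexp : ∀ a : Finset ι, (∑ i ∈ a, H i).det =
      ∑ r : κ → ι, if ∀ k, r k ∈ a then (Matrix.of fun k => H (r k) k).det else 0 := by
    intro a
    have h1 : (∑ i ∈ a, H i) = fun k => ∑ i ∈ a, H i k := by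
      ext k l
      simp [Matrix.sum_apply]
    have h2 := (Matrix.detRowAlternating (n := κ) (R := ℝ)).toMultilinearMap.map_sum_finset
      (fun (k : κ) (i : ι) => H i k) (fun _ => a)
    rw [h1]
    refine h2.trans ?_
    rw [← Finset.sum_filter]
    refine Finset.sum_congr ?_ fun _ _ => rfl
    ext r
    simp [Fintype.mem_piFinset]
  simp only [hexp, Finset.mul_sum]
  rw [Finset.sum_comm]
  refine Finset.sum_eq_zero fun r _ => ?_
  obtain ⟨i₀, hi₀⟩ : ∃ i₀, ∀ k, r k ≠ i₀ := by
    by_contra! h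
    exact hcard.not_ge (Fintype.card_le_of_surjective r h)
  refine sum_neg_one_pow_card_mul_eq_zero i₀ _ fun a _ => ?_
  simp [hi₀]

lemma sum_neg_one_pow_card_mul_volume_convexHull [Nonempty κ]
    (hcard : Fintype.card κ < Fintype.card ι) (A : ι → Finset (κ → ℝ))
    (hA : ∀ i, (interior (convexHull ℝ (A i : Set (κ → ℝ)))).Nonempty) :
    ∑ a : Finset ι, (-1 : ℝ) ^ a.card *
      (volume (∑ i ∈ a, convexHull ℝ (A i : Set (κ → ℝ)))).toReal = 0 := by
  have hvol : ∀ a : Finset ι, Integrable (fun x => (∑ i ∈ a, gibbsCov (A i) x).det) ∧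
      ∫ x, (∑ i ∈ a, gibbsCov (A i) x).det =
        (volume (∑ i ∈ a, convexHull ℝ (A i : Set (κ → ℝ)))).toReal := by
    intro a
    rcases a.eq_empty_or_nonempty with rfl | ha
    · simp [← Set.singleton_zero]
    · exact hasIntegral_det_sum_gibbsCov ha fun i _ => hA i
  simp only [← (hvol _).2, ← integral_const_mul]
  rw [← integral_finsetSum _ fun a _ => (hvol a).1.const_mul _]
  simp [sum_neg_one_pow_card_mul_det_eq_zero hcard]

omit [DecidableEq κ] in
/-- A compact convex set is approximated from outside by full-dimensional polytopes. -/
lemma exists_convexHull_between {K : Set (κ → ℝ)} (hK : IsCompact K) (hKc : Convex ℝ K)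
    (hKne : K.Nonempty) {ε : ℝ} (hε : 0 < ε) :
    ∃ A : Finset (κ → ℝ), (interior (convexHull ℝ (A : Set (κ → ℝ)))).Nonempty ∧
      K ⊆ convexHull ℝ (A : Set (κ → ℝ)) ∧
      convexHull ℝ (A : Set (κ → ℝ)) ⊆ K + Metric.closedBall 0 ε := by
  classical
  obtain ⟨b, hb0, hbs⟩ := exists_mem_interior_convexHull_affineBasis
    (Metric.closedBall_mem_nhds (0 : κ → ℝ) hε)
  set V := Set.range b
  have hV : V.Finite := Set.finite_range b
  obtain ⟨t, htK, htf, hcov⟩ := hK.elim_finite_subcover_image (b := K)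
    (c := fun k => k +ᵥ interior (convexHull ℝ V)) (fun k _ => isOpen_interior.vadd k)
    (fun k hk => Set.mem_iUnion₂.2 ⟨k, hk, Set.mem_vadd_set.2 ⟨0, hb0, by simp⟩⟩)
  have hfin : (t + V).Finite := htf.add hV
  refine ⟨hfin.toFinset, ?_, ?_, ?_⟩
  all_goals rw [hfin.coe_toFinset, convexHull_add]
  · obtain ⟨k, hk⟩ := hKne
    obtain ⟨x, hx, -⟩ := Set.mem_iUnion₂.1 (hcov hk)
    refine ⟨x + 0, interior_mono Set.Subset.rfl (subset_interior_add_right ?_)⟩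
    exact Set.add_mem_add (subset_convexHull ℝ _ hx) hb0
  · intro k hk
    obtain ⟨x, hx, hkx⟩ := Set.mem_iUnion₂.1 (hcov hk)
    obtain ⟨y, hy, rfl⟩ := Set.mem_vadd_set.1 hkx
    exact Set.add_mem_add (subset_convexHull ℝ _ hx) (interior_subset hy)
  · exact Set.add_subset_add (convexHull_min htK hKc) hbs

omit [Fintype ι] [DecidableEq κ] in
lemma sum_closedBall_subset {E : Type*} [SeminormedAddCommGroup E] (a : Finset ι) (ε : ℝ) :
    ∑ _i ∈ a, Metric.closedBall (0 : E) ε ⊆ Metric.closedBall 0 (a.card * ε) := by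
  intro x hx
  obtain ⟨g, hg, rfl⟩ := (Set.mem_finsetSum _ _ _).1 hx
  rw [mem_closedBall_zero_iff]
  refine (norm_sum_le _ _).trans ((Finset.sum_le_card_nsmul _ _ ε fun i hi => ?_).trans_eq
    (nsmul_eq_mul _ _))
  exact mem_closedBall_zero_iff.1 (hg hi)

/-- In dimension `d`, the alternating sum of volumes of Minkowski sums of more than `d` convex
bodies vanishes. -/
lemma sum_neg_one_pow_card_mul_volume_eq_zero [Nonempty κ]
    (hcard : Fintype.card κ < Fintype.card ι) (K : ι → Set (κ → ℝ))
    (hK : ∀ i, IsCompact (K i)) (hKc : ∀ i, Convex ℝ (K i)) (hKne : ∀ i, (K i).Nonempty) :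
    ∑ a : Finset ι, (-1 : ℝ) ^ a.card * (volume (∑ i ∈ a, K i)).toReal = 0 := by
  set ε : ℕ → ℝ := fun k => 1 / ((k : ℝ) + 1)
  have hε : ∀ k, 0 < ε k := fun k => by positivity
  have hε0 : Filter.Tendsto ε Filter.atTop (nhds 0) := tendsto_one_div_add_atTop_nhds_zero_nat
  choose A hAint hKA hAK using fun (k : ℕ) (i : ι) =>
    exists_convexHull_between (hK i) (hKc i) (hKne i) (hε k)
  have hlim : ∀ a : Finset ι, Filter.Tendsto (fun k =>
      (volume (∑ i ∈ a, convexHull ℝ (A k i : Set (κ → ℝ)))).toReal) Filter.atTop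
      (nhds (volume (∑ i ∈ a, K i)).toReal) := by
    intro a
    have hcpt : IsCompact (∑ i ∈ a, K i) := isCompact_finsetSum a fun i _ => hK i
    refine (ENNReal.tendsto_toReal hcpt.measure_ne_top).comp ?_
    have hδ : Filter.Tendsto (fun k => (a.card : ℝ) * ε k) Filter.atTop (nhds 0) := by
      simpa using hε0.const_mul (a.card : ℝ)
    refine tendsto_of_tendsto_of_tendsto_of_le_of_le tendsto_const_nhds
      ((tendsto_measure_cthickening_of_isCompact (μ := volume) hcpt).comp hδ)
      (fun k => measure_mono ?_) (fun k => measure_mono ?_)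
    · exact Set.finsetSum_subset_finsetSum _ _ _ fun i _ => hKA k i
    · rw [← hcpt.add_closedBall_zero (by have := hε k; positivity)]
      refine (Set.finsetSum_subset_finsetSum _ _ _ fun i _ => hAK k i).trans ?_
      rw [Finset.sum_add_distrib]
      exact Set.add_subset_add_left (sum_closedBall_subset a (ε k))
  refine tendsto_nhds_unique (tendsto_finsetSum _ fun a _ => (hlim a).const_mul _) ?_
  simp [sum_neg_one_pow_card_mul_volume_convexHull hcard _ (hAint _)]

omit [Fintype κ] [DecidableEq κ] in
lemma sum_finset_option [DecidableEq ι] (f : Finset (Option ι) → ℝ) :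
    ∑ a, f a = ∑ b : Finset ι, f (b.map Function.Embedding.some) +
      ∑ b : Finset ι, f (Finset.insertNone b) := by
  rw [← Finset.sum_filter_not_add_sum_filter Finset.univ (fun a : Finset (Option ι) => none ∈ a)]
  congr 1
  · refine Finset.sum_nbij' Finset.eraseNone (fun b => b.map Function.Embedding.some)
      (by simp) (by simp) (fun a ha => ?_) (by simp) (fun a ha => ?_)
    all_goals
      have : none ∉ a := by simpa using ha
      simp [Finset.erase_eq_of_notMem this]
  · refine Finset.sum_nbij' Finset.eraseNone Finset.insertNone
      (by simp) (by simp) (fun a ha => ?_) (by simp) (fun a ha => ?_)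
    all_goals
      have : none ∈ a := by simpa using ha
      simp [Finset.insert_eq_self.2 this]

/-- The top-order difference of the volume with respect to `d` convex bodies in dimension `d`
does not depend on the body at which it is taken. -/
lemma sum_neg_one_pow_card_mul_volume_add (hcard : Fintype.card κ = Fintype.card ι)
    (Q : ι → Set (κ → ℝ)) (hQ : ∀ i, IsCompact (Q i)) (hQc : ∀ i, Convex ℝ (Q i))
    (hQne : ∀ i, (Q i).Nonempty) {K : Set (κ → ℝ)} (hK : IsCompact K) (hKc : Convex ℝ K)
    (hKne : K.Nonempty) :
    ∑ a : Finset ι, (-1 : ℝ) ^ a.card * (volume (∑ i ∈ a, Q i + K)).toReal =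
      ∑ a : Finset ι, (-1 : ℝ) ^ a.card * (volume (∑ i ∈ a, Q i)).toReal := by
  classical
  rcases isEmpty_or_nonempty κ with hκ | hκ
  · have hK0 : K = 0 := by
      rw [← Set.singleton_zero]
      exact hKne.subset_singleton_iff.1 fun x _ => Subsingleton.elim _ _
    simp [hK0]
  · have h := sum_neg_one_pow_card_mul_volume_eq_zero (κ := κ) (ι := Option ι)
      (by rw [Fintype.card_option]; omega) (fun o => o.elim K Q)
      (fun o => by cases o <;> simp [hK, hQ]) (fun o => by cases o <;> simp [hKc, hQc])
      (fun o => by cases o <;> simp [hKne, hQne])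
    rw [sum_finset_option] at h
    simp only [Finset.card_map, Finset.sum_map, Finset.card_insertNone, pow_succ,
      Function.Embedding.some_apply, Option.elim_some] at h
    have hs : ∀ b : Finset ι, ∑ o ∈ Finset.insertNone b, (o.elim K Q : Set (κ → ℝ)) =
        ∑ i ∈ b, Q i + K := by
      intro b
      rw [Finset.sum_insertNone, add_comm]
      rfl
    simp only [hs, mul_neg, mul_one, neg_mul, Finset.sum_neg_distrib] at h
    linarith

end Polarization

section Product

variable {κ lam ι ι' : Type*} [Fintype κ] [Fintype lam] [Fintype ι] [Fintype ι']

/-- The volume of a compact subset of a product is the integral of the volumes of its slices. -/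
lemma integral_volume_slice {T : Set ((κ → ℝ) × (lam → ℝ))} (hT : IsCompact T) :
    Integrable (fun y => (volume ((fun x => (x, y)) ⁻¹' T)).toReal) ∧
      ∫ y, (volume ((fun x => (x, y)) ⁻¹' T)).toReal = (volume T).toReal := by
  have hlin : ∫⁻ y, volume ((fun x => (x, y)) ⁻¹' T) = volume T :=
    (Measure.prod_apply_symm hT.measurableSet).symm
  have hmeas : Measurable fun y => volume ((fun x : κ → ℝ => (x, y)) ⁻¹' T) :=
    measurable_measure_prodMk_right hT.measurableSet
  have hne : ∫⁻ y, volume ((fun x => (x, y)) ⁻¹' T) ≠ ⊤ := by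
    rw [hlin]; exact hT.measure_ne_top
  refine ⟨integrable_toReal_of_lintegral_ne_top hmeas.aemeasurable hne, ?_⟩
  rw [integral_toReal hmeas.aemeasurable (ae_lt_top hmeas hne), hlin]

omit [Fintype κ] [Fintype lam] in
lemma slice_prod_zero_add (A : Set (κ → ℝ)) (S : Set ((κ → ℝ) × (lam → ℝ))) (y : lam → ℝ) :
    (fun x => (x, y)) ⁻¹' (A ×ˢ (0 : Set (lam → ℝ)) + S) = A + (fun x => (x, y)) ⁻¹' S := by
  ext x
  simp only [Set.mem_preimage, Set.mem_add]
  constructor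
  · rintro ⟨⟨u, v⟩, ⟨hu, hv⟩, ⟨u', v'⟩, hS, h⟩
    obtain ⟨h1, h2⟩ := Prod.mk.inj h
    obtain rfl : v = 0 := hv
    refine ⟨u, hu, u', ?_, h1⟩
    simp only [zero_add] at h2
    exact h2 ▸ hS
  · rintro ⟨u, hu, u', hS, rfl⟩
    exact ⟨(u, 0), ⟨hu, rfl⟩, (u', y), hS, by simp⟩

lemma sum_neg_one_pow_card_mul_volume_prod_zero_add (hcard : Fintype.card κ = Fintype.card ι)
    (A : ι → Set (κ → ℝ)) (hA : ∀ i, IsCompact (A i)) (hAc : ∀ i, Convex ℝ (A i))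
    (hAne : ∀ i, (A i).Nonempty) {S : Set ((κ → ℝ) × (lam → ℝ))} (hS : IsCompact S)
    (hSc : Convex ℝ S) :
    ∑ a : Finset ι, (-1 : ℝ) ^ a.card *
        (volume ((∑ i ∈ a, A i) ×ˢ (0 : Set (lam → ℝ)) + S)).toReal =
      (∑ a : Finset ι, (-1 : ℝ) ^ a.card * (volume (∑ i ∈ a, A i)).toReal) *
        (volume (Prod.snd '' S)).toReal := by
  classical
  set c := ∑ a : Finset ι, (-1 : ℝ) ^ a.card * (volume (∑ i ∈ a, A i)).toReal with hc
  have hT : ∀ a : Finset ι, IsCompact ((∑ i ∈ a, A i) ×ˢ (0 : Set (lam → ℝ)) + S) := fun a =>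
    ((isCompact_finsetSum a fun i _ => hA i).prod (by simp [← Set.singleton_zero])).add hS
  simp only [← (integral_volume_slice (hT _)).2, ← integral_const_mul]
  rw [← integral_finsetSum _ fun a _ => ((integral_volume_slice (hT a)).1.const_mul _)]
  simp only [slice_prod_zero_add]
  have hpt : ∀ y, ∑ a : Finset ι, (-1 : ℝ) ^ a.card *
      (volume (∑ i ∈ a, A i + (fun x => (x, y)) ⁻¹' S)).toReal =
      (Prod.snd '' S).indicator (fun _ => c) y := by
    intro y
    by_cases hy : y ∈ Prod.snd '' S
    · rw [Set.indicator_of_mem hy]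
      obtain ⟨⟨x, y⟩, hxy, rfl⟩ := hy
      refine sum_neg_one_pow_card_mul_volume_add hcard A hA hAc hAne ?_ ?_ ⟨x, hxy⟩
      · exact (hS.image continuous_fst).of_isClosed_subset
          (hS.isClosed.preimage (by fun_prop)) fun u hu => ⟨_, hu, rfl⟩
      · intro u hu v hv s t hs ht hst
        have := hSc hu hv hs ht hst
        simpa [← add_smul, hst] using this
    · rw [Set.indicator_of_notMem hy]
      have : (fun x => (x, y)) ⁻¹' S = ∅ := by
        ext x
        simp only [Set.mem_preimage, Set.mem_empty_iff_false, iff_false]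
        exact fun h => hy ⟨_, h, rfl⟩
      simp [this]
  simp only [hpt]
  rw [integral_indicator_const _ (hS.image continuous_snd).measurableSet, smul_eq_mul, mul_comm]
  rfl

/-- The product formula for alternating sums of volumes. -/
lemma sum_sum_neg_one_pow_card_mul_volume (hcard : Fintype.card κ = Fintype.card ι)
    (A : ι → Set (κ → ℝ)) (hA : ∀ i, IsCompact (A i)) (hAc : ∀ i, Convex ℝ (A i))
    (hAne : ∀ i, (A i).Nonempty) (B : ι' → Set ((κ → ℝ) × (lam → ℝ)))
    (hB : ∀ i, IsCompact (B i)) (hBc : ∀ i, Convex ℝ (B i)) :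
    ∑ a : Finset ι, ∑ b : Finset ι', (-1 : ℝ) ^ a.card * (-1 : ℝ) ^ b.card *
        (volume ((∑ i ∈ a, A i) ×ˢ (0 : Set (lam → ℝ)) + ∑ i ∈ b, B i)).toReal =
      (∑ a : Finset ι, (-1 : ℝ) ^ a.card * (volume (∑ i ∈ a, A i)).toReal) *
        ∑ b : Finset ι', (-1 : ℝ) ^ b.card * (volume (∑ i ∈ b, Prod.snd '' B i)).toReal := by
  rw [Finset.sum_comm, Finset.mul_sum]
  refine Finset.sum_congr rfl fun b _ => ?_
  have h := sum_neg_one_pow_card_mul_volume_prod_zero_add hcard A hA hAc hAne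
    (isCompact_finsetSum b fun i _ => hB i) (convex_finsetSum b fun i _ => hBc i)
  have h2 := Set.image_finsetSum (LinearMap.snd ℝ (κ → ℝ) (lam → ℝ)) b B
  simp only [LinearMap.coe_snd] at h2
  rw [h2] at h
  rw [mul_left_comm, ← h, Finset.mul_sum]
  exact Finset.sum_congr rfl fun a _ => by ring

end Product

lemma mixedVolume_eq_sum (k : ℕ) (Q : Fin k → Set (Fin k → ℝ)) :
    mixedVolume k Q = (-1 : ℝ) ^ k *
      ∑ a : Finset (Fin k), (-1 : ℝ) ^ a.card * (volume (∑ i ∈ a, Q i)).toReal := by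
  rcases eq_or_ne k 0 with rfl | hk
  · rw [mixedVolume, if_pos rfl, Fintype.sum_unique]
    have : (default : Finset (Fin 0)) = ∅ := Subsingleton.elim _ _
    rw [this, Finset.sum_empty, Measure.volume_pi_eq_dirac (0 : Fin 0 → ℝ),
      Measure.dirac_apply_of_mem (Set.zero_mem_zero)]
    simp
  · have : NeZero k := ⟨hk⟩
    rw [mixedVolume, if_neg hk, Finset.powerset_univ, Finset.mul_sum]
    refine Finset.sum_congr rfl fun a _ => ?_
    split_ifs with ha
    · have hak : a.card ≤ k := by simpa using a.card_le_univ
      rw [Fintype.card_fin, ← mul_assoc, ← pow_add]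
      congr 1
      rw [show k + a.card = (k - a.card) + 2 * a.card by omega, pow_add, pow_mul]
      simp
    · obtain rfl := Finset.not_nonempty_iff_eq_empty.1 ha
      simp [← Set.singleton_zero]

section LatticeCoordinates

/-- Two real-linear maps that agree on integer vectors are equal. -/
lemma LinearMap.ext_castR {k : ℕ} {F : Type*} [AddCommGroup F] [Module ℝ F]
    {f g : (Fin k → ℝ) →ₗ[ℝ] F} (h : ∀ z, f (castR k z) = g (castR k z)) : f = g := by
  refine (Pi.basisFun ℝ (Fin k)).ext fun i => ?_
  have : Pi.basisFun ℝ (Fin k) i = castR k (Pi.single i 1) := by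
    ext l
    simp [castR, Pi.single_apply]
  rw [this, h]

lemma castR_zero (k : ℕ) : castR k 0 = 0 := by
  ext; simp [castR]

/-- Concatenation of vectors as a linear equivalence. -/
def appendLinearEquiv (R : Type*) [Semiring R] (m r : ℕ) :
    ((Fin m → R) × (Fin r → R)) ≃ₗ[R] (Fin (m + r) → R) :=
  (LinearEquiv.sumArrowLequivProdArrow (Fin m) (Fin r) R R).symm ≪≫ₗ
    LinearEquiv.funCongrLeft R R finSumFinEquiv.symm

lemma castR_appendLinearEquiv {m r : ℕ} (x : Fin m → ℤ) (y : Fin r → ℤ) :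
    castR (m + r) (appendLinearEquiv ℤ m r (x, y)) =
      appendLinearEquiv ℝ m r (castR m x, castR r y) := by
  ext k
  obtain ⟨l, rfl⟩ := finSumFinEquiv.surjective k
  simp only [castR, appendLinearEquiv, LinearEquiv.trans_apply, LinearEquiv.funCongrLeft_apply,
    LinearMap.funLeft_apply, Equiv.symm_apply_apply]
  cases l <;> rfl

lemma measurePreserving_appendLinearEquiv (m r : ℕ) :
    MeasurePreserving (appendLinearEquiv ℝ m r) := by
  have h1 := volume_measurePreserving_sumPiEquivProdPi_symm (fun _ : Fin m ⊕ Fin r => ℝ)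
  have h2 := volume_measurePreserving_piCongrLeft (fun _ : Fin (m + r) => ℝ)
    (finSumFinEquiv (m := m) (n := r))
  have he : ⇑(appendLinearEquiv ℝ m r) =
      MeasurableEquiv.piCongrLeft (fun _ : Fin (m + r) => ℝ) finSumFinEquiv ∘
        (MeasurableEquiv.sumPiEquivProdPi fun _ : Fin m ⊕ Fin r => ℝ).symm := by
    ext z k
    obtain ⟨l, rfl⟩ := finSumFinEquiv.surjective k
    rw [Function.comp_apply, MeasurableEquiv.coe_piCongrLeft, Equiv.piCongrLeft_apply_apply]
    simp only [appendLinearEquiv, LinearEquiv.trans_apply, LinearEquiv.funCongrLeft_apply,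
      LinearMap.funLeft_apply, Equiv.symm_apply_apply]
    cases l <;> rfl
  rw [he]
  exact h2.comp h1

/-- The real extension of an automorphism of `ℤ^k` preserves volume. -/
lemma exists_measurePreserving_extension {k : ℕ} (T : (Fin k → ℤ) ≃ₗ[ℤ] (Fin k → ℤ)) :
    ∃ Φ : (Fin k → ℝ) ≃ₗ[ℝ] (Fin k → ℝ), MeasurePreserving Φ ∧
      ∀ z, Φ (castR k z) = castR k (T z) := by
  set M : Matrix (Fin k) (Fin k) ℤ := LinearMap.toMatrix' T.toLinearMap
  set N : Matrix (Fin k) (Fin k) ℝ := M.map (Int.castRingHom ℝ)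
  have hM : IsUnit M.det := by
    have := T.isUnit_det'
    rwa [← LinearMap.det_toMatrix'] at this
  have hdet : N.det = (M.det : ℝ) := ((Int.castRingHom ℝ).map_det M).symm
  have habs : |N.det| = 1 := by
    rw [hdet, ← Int.cast_abs, Int.isUnit_iff_abs_eq.1 hM, Int.cast_one]
  have hN : N.det ≠ 0 := fun h => by simp [h] at habs
  refine ⟨LinearEquiv.ofIsUnitDet (f := Matrix.toLin' N) (v := Pi.basisFun ℝ _)
    (v' := Pi.basisFun ℝ _) ?_, ⟨?_, ?_⟩, fun z => ?_⟩
  · rw [LinearMap.toMatrix_eq_toMatrix', LinearMap.toMatrix'_toLin']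
    exact hN.isUnit
  · exact (LinearMap.continuous_of_finiteDimensional (Matrix.toLin' N)).measurable
  · refine (Real.map_matrix_volume_pi_eq_smul_volume_pi hN).trans ?_
    rw [abs_inv, habs]
    simp
  · have hT : T z = M.mulVec z := (LinearMap.toMatrix'_mulVec T.toLinearMap z).symm
    rw [hT]
    refine (Matrix.toLin'_apply N (castR k z)).trans ?_
    ext l
    simp [castR, Matrix.mulVec, dotProduct, N]

/-- Volume-preserving coordinates adapted to an exact sequence of lattices
`0 → ℤ^m → ℤ^(m+r) → ℤ^r → 0`. -/
lemma exists_adapted_coordinates {m r : ℕ}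
    (j : (Fin m → ℤ) →ₗ[ℤ] (Fin (m + r) → ℤ)) (hjinj : Function.Injective j)
    (p : (Fin (m + r) → ℤ) →ₗ[ℤ] (Fin r → ℤ)) (hpsurj : Function.Surjective p)
    (hexact : LinearMap.range j = LinearMap.ker p)
    (jR : (Fin m → ℝ) →ₗ[ℝ] (Fin (m + r) → ℝ))
    (hjR : ∀ x : Fin m → ℤ, jR (castR m x) = castR (m + r) (j x))
    (pR : (Fin (m + r) → ℝ) →ₗ[ℝ] (Fin r → ℝ))
    (hpR : ∀ x : Fin (m + r) → ℤ, pR (castR (m + r) x) = castR r (p x)) :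
    ∃ Φ : ((Fin m → ℝ) × (Fin r → ℝ)) ≃ₗ[ℝ] (Fin (m + r) → ℝ), MeasurePreserving Φ ∧
      (∀ x, Φ (x, 0) = jR x) ∧ ∀ z, pR (Φ z) = z.2 := by
  obtain ⟨s, hs⟩ := Module.projective_lifting_property p LinearMap.id hpsurj
  have hps : ∀ y, p (s y) = y := fun y => LinearMap.congr_fun hs y
  have hpj : ∀ x, p (j x) = 0 := fun x => by
    rw [← LinearMap.mem_ker, ← hexact]; exact ⟨x, rfl⟩
  have hbij : Function.Bijective (j.coprod s) := by
    constructor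
    · rw [← LinearMap.ker_eq_bot, LinearMap.ker_eq_bot']
      rintro ⟨x, y⟩ h
      rw [LinearMap.coprod_apply] at h
      have hy : y = 0 := by simpa [hpj, hps] using congrArg p h
      subst hy
      rw [map_zero, add_zero] at h
      exact Prod.ext ((map_eq_zero_iff j hjinj).1 h) rfl
    · intro z
      have : z - s (p z) ∈ LinearMap.range j := by
        rw [hexact, LinearMap.mem_ker, map_sub, hps, sub_self]
      obtain ⟨x, hx⟩ := this
      exact ⟨(x, p z), by rw [LinearMap.coprod_apply, hx, sub_add_cancel]⟩
  obtain ⟨Ψ, hΨ, hΨz⟩ := exists_measurePreserving_extension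
    ((appendLinearEquiv ℤ m r).symm ≪≫ₗ LinearEquiv.ofBijective (j.coprod s) hbij)
  set Φ := appendLinearEquiv ℝ m r ≪≫ₗ Ψ with hΦdef
  have hΦ : ∀ x y, Φ (castR m x, castR r y) = castR (m + r) (j x + s y) := by
    intro x y
    rw [hΦdef, LinearEquiv.trans_apply, ← castR_appendLinearEquiv, hΨz]
    simp
  refine ⟨Φ, hΨ.comp (measurePreserving_appendLinearEquiv m r), fun x => ?_, fun z => ?_⟩
  · have : Φ.toLinearMap ∘ₗ LinearMap.inl ℝ _ _ = jR := LinearMap.ext_castR fun x => by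
      simpa [castR_zero, hjR] using hΦ x 0
    exact LinearMap.congr_fun this x
  · have : pR ∘ₗ Φ.toLinearMap = LinearMap.snd ℝ (Fin m → ℝ) (Fin r → ℝ) := by
      refine LinearMap.prod_ext (LinearMap.ext_castR fun x => ?_) (LinearMap.ext_castR fun y => ?_)
      · have := hΦ x 0
        rw [castR_zero] at this
        simp [this, hpR, hpj, castR_zero]
      · have := hΦ 0 y
        rw [castR_zero] at this
        simp [this, hpR, hps]
    exact LinearMap.congr_fun this z

end LatticeCoordinates

lemma sum_finset_fin_add {m r : ℕ} (f : Finset (Fin (m + r)) → ℝ) :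
    ∑ s, f s = ∑ a : Finset (Fin m), ∑ b : Finset (Fin r),
      f ((a.disjSum b).map finSumFinEquiv.toEmbedding) := by
  rw [← Fintype.sum_prod_type' fun (a : Finset (Fin m)) (b : Finset (Fin r)) =>
    f ((a.disjSum b).map finSumFinEquiv.toEmbedding)]
  exact (Equiv.sum_comp (Finset.sumEquiv.symm.toEquiv.trans finSumFinEquiv.finsetCongr) f).symm

/-- The product formula for mixed volumes in adapted coordinates. -/
lemma mixedVolume_add_eq_mul {m r : ℕ} (P : Fin (m + r) → Set (Fin (m + r) → ℝ))
    (hPc : ∀ i, IsCompact (P i)) (hPcv : ∀ i, Convex ℝ (P i)) (hPne : ∀ i, (P i).Nonempty)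
    (jR : (Fin m → ℝ) →ₗ[ℝ] (Fin (m + r) → ℝ)) (pR : (Fin (m + r) → ℝ) →ₗ[ℝ] (Fin r → ℝ))
    (hPL : ∀ i : Fin m, P (Fin.castAdd r i) ⊆ Set.range jR)
    (Φ : ((Fin m → ℝ) × (Fin r → ℝ)) ≃ₗ[ℝ] (Fin (m + r) → ℝ)) (hΦ : MeasurePreserving Φ)
    (hΦj : ∀ x, Φ (x, 0) = jR x) (hΦp : ∀ z, pR (Φ z) = z.2) :
    mixedVolume (m + r) P =
      mixedVolume m (fun i => jR ⁻¹' P (Fin.castAdd r i)) *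
        mixedVolume r (fun i => pR '' P (Fin.natAdd m i)) := by
  set A : Fin m → Set (Fin m → ℝ) := fun i => jR ⁻¹' P (Fin.castAdd r i) with hA
  set B : Fin r → Set ((Fin m → ℝ) × (Fin r → ℝ)) := fun i => Φ ⁻¹' P (Fin.natAdd m i) with hB
  set e := Φ.toContinuousLinearEquiv
  have hpre : ∀ Q : Set (Fin (m + r) → ℝ), IsCompact Q → IsCompact (Φ ⁻¹' Q) := fun Q hQ =>
    e.toHomeomorph.isCompact_preimage.2 hQ
  have hjA : ∀ i, jR '' A i = P (Fin.castAdd r i) := fun i =>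
    Set.image_preimage_eq_of_subset (hPL i)
  have hΦB : ∀ i, Φ '' B i = P (Fin.natAdd m i) := fun i =>
    Set.image_preimage_eq _ Φ.surjective
  have hsnd : ∀ i, pR '' P (Fin.natAdd m i) = Prod.snd '' B i := fun i => by
    rw [← hΦB, Set.image_image]
    simp only [hΦp]
  have hAcomp : ∀ i, IsCompact (A i) := fun i => by
    refine ((hpre _ (hPc (Fin.castAdd r i))).image continuous_fst).of_isClosed_subset
      ((hPc _).isClosed.preimage jR.continuous_of_finiteDimensional) fun x hx => ⟨(x, 0), ?_, rfl⟩
    rw [Set.mem_preimage, hΦj]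
    exact hx
  have hAconv : ∀ i, Convex ℝ (A i) := fun i => (hPcv _).linear_preimage jR
  have hAne : ∀ i, (A i).Nonempty := fun i => by
    rw [← Set.image_nonempty (f := jR), hjA]
    exact hPne _
  have hBcomp : ∀ i, IsCompact (B i) := fun i => hpre _ (hPc _)
  have hBconv : ∀ i, Convex ℝ (B i) := fun i => (hPcv _).linear_preimage Φ.toLinearMap
  have hvol : ∀ (a : Finset (Fin m)) (b : Finset (Fin r)),
      volume (∑ i ∈ (a.disjSum b).map finSumFinEquiv.toEmbedding, P i) =
        volume ((∑ i ∈ a, A i) ×ˢ (0 : Set (Fin r → ℝ)) + ∑ i ∈ b, B i) := by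
    intro a b
    have hj : Φ '' ((∑ i ∈ a, A i) ×ˢ (0 : Set (Fin r → ℝ))) = ∑ i ∈ a, P (Fin.castAdd r i) := by
      simp only [← hjA]
      rw [← Set.image_finsetSum jR, ← Set.singleton_zero, Set.prod_singleton, Set.image_image]
      simp only [hΦj]
    have himg : Φ '' ((∑ i ∈ a, A i) ×ˢ (0 : Set (Fin r → ℝ)) + ∑ i ∈ b, B i) =
        ∑ i ∈ (a.disjSum b).map finSumFinEquiv.toEmbedding, P i := by
      rw [Set.image_add, hj, Set.image_finsetSum Φ, Finset.sum_map, Finset.sum_disjSum]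
      simp only [hΦB]
      rfl
    rw [← himg, ← hΦ.measure_preimage_emb e.toHomeomorph.measurableEmbedding,
      Set.preimage_image_eq _ Φ.injective]
  rw [mixedVolume_eq_sum, mixedVolume_eq_sum, mixedVolume_eq_sum, sum_finset_fin_add]
  simp only [hvol, Finset.card_map, Finset.card_disjSum, pow_add, hsnd]
  rw [sum_sum_neg_one_pow_card_mul_volume rfl A hAcomp hAconv hAne B hBcomp hBconv]
  ring

lemma mixedVolume_subspace_mul_quotient_of_eq_add {n m r : ℕ} (hn : n = m + r) (hm : m ≤ n)
    (L : Submodule ℤ (Fin n → ℤ))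
    (P : Fin n → Set (Fin n → ℝ))
    (hPc : ∀ i, IsCompact (P i)) (hPcv : ∀ i, Convex ℝ (P i))
    (hPne : ∀ i, (P i).Nonempty)
    (hPL : ∀ i : Fin n, (i : ℕ) < m →
      P i ⊆ ↑(Submodule.span ℝ (castR n '' (L : Set (Fin n → ℤ)))))
    (j : (Fin m → ℤ) →ₗ[ℤ] (Fin n → ℤ)) (hjinj : Function.Injective j)
    (hjrange : LinearMap.range j = L)
    (jR : (Fin m → ℝ) →ₗ[ℝ] (Fin n → ℝ))
    (hjR : ∀ x : Fin m → ℤ, jR (castR m x) = castR n (j x))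
    (p : (Fin n → ℤ) →ₗ[ℤ] (Fin r → ℤ)) (hpsurj : Function.Surjective p)
    (hpker : LinearMap.ker p = L)
    (pR : (Fin n → ℝ) →ₗ[ℝ] (Fin r → ℝ))
    (hpR : ∀ x : Fin n → ℤ, pR (castR n x) = castR r (p x)) :
    mixedVolume n P =
      mixedVolume m (fun i : Fin m => jR ⁻¹' P (Fin.castLE hm i)) *
        mixedVolume r (fun i : Fin r => pR '' P ⟨m + i, by omega⟩) := by
  subst hn
  obtain ⟨Φ, hΦ, hΦj, hΦp⟩ := exists_adapted_coordinates j hjinj p hpsurj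
    (hjrange.trans hpker.symm) jR hjR pR hpR
  refine mixedVolume_add_eq_mul P hPc hPcv hPne jR pR (fun i => ?_) Φ hΦ hΦj hΦp
  refine (hPL (Fin.castAdd r i) (by simp)).trans ?_
  have : Submodule.span ℝ (castR (m + r) '' (L : Set (Fin (m + r) → ℤ))) ≤ LinearMap.range jR := by
    rw [Submodule.span_le]
    rintro _ ⟨z, hz, rfl⟩
    rw [← hjrange] at hz
    obtain ⟨x, rfl⟩ := hz
    exact ⟨castR m x, hjR x⟩
  exact this

/-- Let `L ⊆ ℤ^n` be a saturated sublattice of rank `m` and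
`P_1, …, P_n` convex bodies in `ℝ^n` with `P_i ⊆ L ⊗ ℝ` for `i = 1, …, m`.  Fixing a
`ℤ`-linear parametrization `j : ℤ^m ≅ L` (identifying `L` with `ℤ^m`) and a `ℤ`-linear
surjection `p : ℤ^n → ℤ^{n-m}` with kernel `L` (identifying `M/L` with `ℤ^{n-m}`),
together with their real extensions `jR`, `pR`, one has
`MV_M(P_1,…,P_n) = MV_L(P_1,…,P_m) * MV_{M/L}(π(P_{m+1}),…,π(P_n))`. -/
theorem mixedVolume_subspace_mul_quotient {n m : ℕ} (hm : m ≤ n)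
    (L : Submodule ℤ (Fin n → ℤ))
    (hsat : ∀ (k : ℤ) (x : Fin n → ℤ), k ≠ 0 → k • x ∈ L → x ∈ L)
    (hrkL : Module.finrank ℤ ↥L = m)
    (P : Fin n → Set (Fin n → ℝ))
    (hPc : ∀ i, IsCompact (P i)) (hPcv : ∀ i, Convex ℝ (P i))
    (hPne : ∀ i, (P i).Nonempty)
    (hPL : ∀ i : Fin n, (i : ℕ) < m →
      P i ⊆ ↑(Submodule.span ℝ (castR n '' (L : Set (Fin n → ℤ)))))
    (j : (Fin m → ℤ) →ₗ[ℤ] (Fin n → ℤ)) (hjinj : Function.Injective j)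
    (hjrange : LinearMap.range j = L)
    (jR : (Fin m → ℝ) →ₗ[ℝ] (Fin n → ℝ))
    (hjR : ∀ x : Fin m → ℤ, jR (castR m x) = castR n (j x))
    (p : (Fin n → ℤ) →ₗ[ℤ] (Fin (n - m) → ℤ)) (hpsurj : Function.Surjective p)
    (hpker : LinearMap.ker p = L)
    (pR : (Fin n → ℝ) →ₗ[ℝ] (Fin (n - m) → ℝ))
    (hpR : ∀ x : Fin n → ℤ, pR (castR n x) = castR (n - m) (p x)) :
    mixedVolume n P =
      mixedVolume m (fun i : Fin m => jR ⁻¹' P (Fin.castLE hm i)) *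
        mixedVolume (n - m) (fun i : Fin (n - m) =>
          pR '' P ⟨m + i, by omega⟩) := by
  exact mixedVolume_subspace_mul_quotient_of_eq_add (Nat.add_sub_cancel' hm).symm hm L P hPc hPcv
    hPne hPL j hjinj hjrange jR hjR p hpsurj hpker pR hpR
end

section
/- Let A_1 be a nonempty finite subset of Z and F_1 = sum_{a in A_1} u_a t^a the general univariate Laurent polynomial with support A_1. Hiding the variable t among the coefficients (i.e., viewing F_1 as a Laurent polynomial in zero variables with coefficients in Q[u][t^{±1}] supported at the single point 0 in Z^0), the resulting 'hidden variable resultant' equals ± F_1 itself, and moreover Res_{{0,1-point support {0}}, A_1}(z - t, F_1) evaluated appropriately satisfies Res_{{0, e}, A_1}(z - t, F_1) = z^{-ord_t(F_1)} F_1(z) up to sign, where ord_t(F_1) = min A_1. -/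
open Pointwise MeasureTheory

noncomputable section

variable {n : ℕ}

/-- Evaluation of the character `χ^a` at a point `ξ` of the torus `(ℂˣ)^n`. -/
def chEval (ξ : Fin n → ℂˣ) (a : Fin n → ℤ) : ℂ :=
  ∏ j, ((ξ j ^ (a j) : ℂˣ) : ℂ)

/-- `ξ` is a common root of the Laurent polynomials with supports `A i` and
coefficients `c i`. -/
def IsRootOf (A : Fin (n + 1) → Finset (Fin n → ℤ))
    (c : Fin (n + 1) → (Fin n → ℤ) → ℂ) (ξ : Fin n → ℂˣ) : Prop :=
  ∀ i, ∑ a ∈ A i, c i a * chEval ξ a = 0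

/-- The family of Laurent polynomials with supports `A` and coefficients `c` has a
common root in the torus. -/
def HasRoot (A : Fin (n + 1) → Finset (Fin n → ℤ))
    (c : Fin (n + 1) → (Fin n → ℤ) → ℂ) : Prop :=
  ∃ ξ, IsRootOf A c ξ

/-- Evaluation of an integer polynomial in the coefficient variables `u_{i,a}` at a
family of complex coefficients. -/
def evalCoeff (R : MvPolynomial (Fin (n + 1) × (Fin n → ℤ)) ℤ)
    (c : Fin (n + 1) → (Fin n → ℤ) → ℂ) : ℂ :=
  MvPolynomial.aeval (fun p => c p.1 p.2) R

/-- `E` is the sparse eliminant of the family of supports `A`: an irreducible integer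
polynomial cutting out the closure of the locus of coefficient families admitting a
common root in the torus, when this closure is a hypersurface, and `1` otherwise. -/
def IsEliminant (A : Fin (n + 1) → Finset (Fin n → ℤ))
    (E : MvPolynomial (Fin (n + 1) × (Fin n → ℤ)) ℤ) : Prop :=
  (Irreducible E ∧ {c | evalCoeff E c = 0} = closure {c | HasRoot A c})
  ∨ (E = 1 ∧ ∀ E' : MvPolynomial (Fin (n + 1) × (Fin n → ℤ)) ℤ,
      ¬ (Irreducible E' ∧ {c | evalCoeff E' c = 0} = closure {c | HasRoot A c}))

/-- `R` is the sparse resultant of the family of supports `A`: up to sign the power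
`E^d` of the sparse eliminant, where `d` is the degree of the projection from the
incidence variety, i.e. the number of common roots of a generic coefficient family in
the vanishing locus. -/
def IsResultant (A : Fin (n + 1) → Finset (Fin n → ℤ))
    (R : MvPolynomial (Fin (n + 1) × (Fin n → ℤ)) ℤ) : Prop :=
  ∃ E d, IsEliminant A E ∧ (R = E ^ d ∨ R = -E ^ d) ∧
    ∃ U : Set (Fin (n + 1) → (Fin n → ℤ) → ℂ), IsOpen U ∧
      closure (U ∩ {c | HasRoot A c}) = closure {c | HasRoot A c} ∧
      ∀ c ∈ U ∩ {c | HasRoot A c}, Nat.card {ξ // IsRootOf A c ξ} = d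


/-- Pseudo-division of `E` by `L * X v + Q`, which is linear in the variable `v`. -/
theorem MvPolynomial.exists_dvd_pow_mul_sub {σ : Type*} (v : σ) (L Q : MvPolynomial σ ℤ)
    (hLv : v ∉ L.vars) (hQv : v ∉ Q.vars) (E : MvPolynomial σ ℤ) :
    ∃ (k : ℕ) (r : MvPolynomial σ ℤ),
      r ∈ MvPolynomial.supported ℤ ({v}ᶜ : Set σ) ∧
        L * MvPolynomial.X v + Q ∣ L ^ k * E - r := by
  have hL : L ∈ MvPolynomial.supported ℤ ({v}ᶜ : Set σ) := by
    rw [MvPolynomial.mem_supported]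
    rintro i hi rfl
    exact hLv hi
  have hQ : Q ∈ MvPolynomial.supported ℤ ({v}ᶜ : Set σ) := by
    rw [MvPolynomial.mem_supported]
    rintro i hi rfl
    exact hQv hi
  induction E using MvPolynomial.induction_on with
  | C a => exact ⟨0, MvPolynomial.C a, Subalgebra.algebraMap_mem _ a, by simp⟩
  | add p q hp hq =>
    obtain ⟨k, r, hr, hd⟩ := hp
    obtain ⟨l, s, hs, he⟩ := hq
    refine ⟨k + l, L ^ l * r + L ^ k * s,
      add_mem (mul_mem (pow_mem hL _) hr) (mul_mem (pow_mem hL _) hs), ?_⟩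
    convert dvd_add (hd.mul_left (L ^ l)) (he.mul_left (L ^ k)) using 1
    ring
  | mul_X p i hp =>
    obtain ⟨k, r, hr, hd⟩ := hp
    by_cases hi : i = v
    · subst hi
      refine ⟨k + 1, r * -Q, mul_mem hr (neg_mem hQ), ?_⟩
      convert dvd_add (hd.mul_left (L * MvPolynomial.X i)) (dvd_mul_left _ r) using 1
      ring
    · refine ⟨k, r * MvPolynomial.X i,
        mul_mem hr (MvPolynomial.X_mem_supported.2 hi), ?_⟩
      convert hd.mul_right (MvPolynomial.X i) using 1
      ring

theorem MvPolynomial.aeval_update_of_notMem_vars {σ : Type*} [DecidableEq σ] {v : σ}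
    {p : MvPolynomial σ ℤ} (hp : v ∉ p.vars) (c : σ → ℂ) (x : ℂ) :
    MvPolynomial.aeval (Function.update c v x) p = MvPolynomial.aeval c p := by
  refine MvPolynomial.eval₂Hom_congr' rfl (fun i hi _ => ?_) rfl
  rw [Function.update_of_ne]
  rintro rfl
  exact hp hi

theorem MvPolynomial.eq_zero_of_aeval_complex {σ : Type*} {p : MvPolynomial σ ℤ}
    (h : ∀ c : σ → ℂ, MvPolynomial.aeval c p = 0) : p = 0 := by
  apply MvPolynomial.map_injective (Int.castRingHom ℂ) Int.cast_injective
  apply MvPolynomial.funext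
  intro c
  have := h c
  rw [MvPolynomial.aeval_def, ← MvPolynomial.eval_map] at this
  simpa using this

theorem MvPolynomial.eq_or_eq_neg_of_associated {σ : Type*} {p q : MvPolynomial σ ℤ}
    (h : Associated p q) : q = p ∨ q = -p := by
  obtain ⟨u, rfl⟩ := h
  obtain ⟨r, hr, hu⟩ := MvPolynomial.isUnit_iff_eq_C_of_isReduced.1 u.isUnit
  rcases Int.isUnit_iff.1 hr with rfl | rfl <;> simp [hu]

/-- An irreducible integer polynomial that vanishes on the complex zeros of an irreducible
polynomial which is linear in one variable equals the latter up to sign. -/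
theorem MvPolynomial.eq_or_eq_neg_of_zeros_subset {σ : Type*} (v : σ)
    (L Q : MvPolynomial σ ℤ) (hL : L ≠ 0) (hLv : v ∉ L.vars) (hQv : v ∉ Q.vars)
    (hLQ : IsRelPrime L Q) {E : MvPolynomial σ ℤ} (hE : Irreducible E)
    (h : ∀ c : σ → ℂ, MvPolynomial.aeval c (L * MvPolynomial.X v + Q) = 0 →
      MvPolynomial.aeval c E = 0) :
    E = L * MvPolynomial.X v + Q ∨ E = -(L * MvPolynomial.X v + Q) := by
  classical
  have hP : Irreducible (L * MvPolynomial.X v + Q) :=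
    MvPolynomial.irreducible_mul_X_add L Q v hL hLv hQv hLQ
  have key : ∀ c : σ → ℂ, MvPolynomial.aeval c L ≠ 0 → ∃ x : ℂ,
      MvPolynomial.aeval (Function.update c v x) (L * MvPolynomial.X v + Q) = 0 := by
    intro c hc
    refine ⟨-MvPolynomial.aeval c Q / MvPolynomial.aeval c L, ?_⟩
    rw [map_add, map_mul, MvPolynomial.aeval_update_of_notMem_vars hLv,
      MvPolynomial.aeval_update_of_notMem_vars hQv, MvPolynomial.aeval_X,
      Function.update_self]
    field_simp
    ring
  obtain ⟨k, r, hr, G, hG⟩ := MvPolynomial.exists_dvd_pow_mul_sub v L Q hLv hQv E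
  have hrv : v ∉ r.vars := fun hv => (MvPolynomial.mem_supported.1 hr) hv rfl
  have hr0 : r * L = 0 := by
    refine MvPolynomial.eq_zero_of_aeval_complex fun c => ?_
    by_cases hc : MvPolynomial.aeval c L = 0
    · simp [hc]
    · obtain ⟨x, hx⟩ := key c hc
      have := congrArg (MvPolynomial.aeval (Function.update c v x)) hG
      rw [map_sub, map_mul, map_mul, h _ hx, hx,
        MvPolynomial.aeval_update_of_notMem_vars hrv] at this
      have h0 : MvPolynomial.aeval c r = 0 := by simpa using this
      simp [h0]
  have hr0 : r = 0 := (mul_eq_zero.1 hr0).resolve_right hL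
  have hnd : ¬ L * MvPolynomial.X v + Q ∣ L := by
    rintro ⟨H, hH⟩
    apply hL
    refine MvPolynomial.eq_zero_of_aeval_complex fun c => ?_
    by_contra hc
    obtain ⟨x, hx⟩ := key c hc
    have := congrArg (MvPolynomial.aeval (Function.update c v x)) hH
    rw [map_mul, hx, zero_mul, MvPolynomial.aeval_update_of_notMem_vars hLv] at this
    exact hc this
  have hdvd : L * MvPolynomial.X v + Q ∣ E := by
    have hp := hP.prime
    refine (hp.dvd_or_dvd (⟨G, by simpa [hr0] using hG⟩ : _ ∣ L ^ k * E)).resolve_left ?_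
    exact fun h => hnd (hp.dvd_of_dvd_pow h)
  exact MvPolynomial.eq_or_eq_neg_of_associated (hP.associated_of_dvd hE hdvd)

/-- If the incidence projection is generically injective and its image closure is cut out by
an irreducible polynomial linear in one variable, then this polynomial is the resultant. -/
theorem IsResultant.eq_or_eq_neg {A : Fin (n + 1) → Finset (Fin n → ℤ)}
    (v : Fin (n + 1) × (Fin n → ℤ)) (L Q : MvPolynomial (Fin (n + 1) × (Fin n → ℤ)) ℤ)
    (hL : L ≠ 0) (hLv : v ∉ L.vars) (hQv : v ∉ Q.vars) (hLQ : IsRelPrime L Q)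
    (hzero : {c | evalCoeff (L * MvPolynomial.X v + Q) c = 0} = closure {c | HasRoot A c})
    (W : Set (Fin (n + 1) → (Fin n → ℤ) → ℂ)) (hW : IsOpen W)
    (hne : (W ∩ {c | HasRoot A c}).Nonempty)
    (hcard : ∀ c ∈ W ∩ {c | HasRoot A c}, Nat.card {ξ // IsRootOf A c ξ} = 1)
    {R : MvPolynomial (Fin (n + 1) × (Fin n → ℤ)) ℤ} (hR : IsResultant A R) :
    R = L * MvPolynomial.X v + Q ∨ R = -(L * MvPolynomial.X v + Q) := by
  obtain ⟨E, d, hE, hRE, U, hU, hUd, hUc⟩ := hR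
  have hd : d = 1 := by
    obtain ⟨c, hcW, hc⟩ := hne
    have hc' : c ∈ closure (U ∩ {c | HasRoot A c}) := hUd ▸ subset_closure hc
    obtain ⟨c', hc'W, hc'U, hc'⟩ := mem_closure_iff.1 hc' W hW hcW
    rw [← hUc c' ⟨hc'U, hc'⟩, hcard c' ⟨hc'W, hc'⟩]
  have hEP : E = L * MvPolynomial.X v + Q ∨ E = -(L * MvPolynomial.X v + Q) := by
    rcases hE with ⟨hE, hEz⟩ | ⟨-, hE⟩
    · refine MvPolynomial.eq_or_eq_neg_of_zeros_subset v L Q hL hLv hQv hLQ hE fun c hc => ?_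
      have : (fun i a => c (i, a)) ∈ {c | evalCoeff E c = 0} := by
        rw [hEz, ← hzero]
        exact hc
      exact this
    · exact absurd ⟨MvPolynomial.irreducible_mul_X_add L Q v hL hLv hQv hLQ, hzero⟩ (hE _)
  subst hd
  rw [pow_one] at hRE
  rcases hEP with rfl | rfl <;> rcases hRE with rfl | rfl <;> simp

theorem resultant_zero_variables {R : MvPolynomial (Fin 1 × (Fin 0 → ℤ)) ℤ}
    (hR : IsResultant (n := 0) (fun _ => {(0 : Fin 0 → ℤ)}) R) :
    R = MvPolynomial.X (0, 0) ∨ R = -MvPolynomial.X (0, 0) := by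
  have hroot : ∀ (c : Fin 1 → (Fin 0 → ℤ) → ℂ) ξ,
      IsRootOf (n := 0) (fun _ => {(0 : Fin 0 → ℤ)}) c ξ ↔ c 0 0 = 0 := by
    intro c ξ
    simp [IsRootOf, chEval]
  have hhas : {c | HasRoot (n := 0) (fun _ => {(0 : Fin 0 → ℤ)}) c} =
      {c : Fin 1 → (Fin 0 → ℤ) → ℂ | c 0 0 = 0} := by
    ext c
    exact ⟨fun ⟨ξ, hξ⟩ => (hroot c ξ).1 hξ, fun h => ⟨fun _ => 1, (hroot c _).2 h⟩⟩
  have := IsResultant.eq_or_eq_neg (n := 0) (0, 0) 1 0 one_ne_zero (by simp) (by simp)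
    isRelPrime_one_left (A := fun _ => {(0 : Fin 0 → ℤ)}) ?_ Set.univ isOpen_univ ?_ ?_ hR
  · simpa using this
  · rw [hhas, IsClosed.closure_eq]
    · simp [evalCoeff]
    · exact isClosed_eq (by fun_prop) continuous_const
  · rw [hhas]
    exact ⟨0, by simp⟩
  · rintro c ⟨-, hc⟩
    have hc0 : c 0 0 = 0 := by
      rw [hhas] at hc
      exact hc
    have : Unique {ξ // IsRootOf (n := 0) (fun _ => {(0 : Fin 0 → ℤ)}) c ξ} :=
      ⟨⟨⟨fun _ => 1, (hroot c _).2 hc0⟩⟩, fun x => Subsingleton.elim _ _⟩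
    exact Nat.card_unique

/-- The supports `{0, 1}` and `A1` of `z - t` and `F_1`. -/
def pairSupport (A1 : Finset ℤ) : Fin 2 → Finset (Fin 1 → ℤ) :=
  Fin.cons ({(fun _ => 0 : Fin 1 → ℤ), fun _ => 1} : Finset (Fin 1 → ℤ))
    (fun _ => A1.image (fun a => (fun _ : Fin 1 => a)))

theorem isRootOf_pairSupport {A1 : Finset ℤ} {c : Fin 2 → (Fin 1 → ℤ) → ℂ}
    {ξ : Fin 1 → ℂˣ} :
    IsRootOf (n := 1) (pairSupport A1) c ξ ↔
      c 0 (fun _ => 0) + c 0 (fun _ => 1) * (ξ 0 : ℂ) = 0 ∧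
        ∑ a ∈ A1, c 1 (fun _ => a) * (ξ 0 : ℂ) ^ a = 0 := by
  have h01 : (fun _ => 0 : Fin 1 → ℤ) ≠ fun _ => 1 := fun h => by
    simpa using congrFun h 0
  have hinj : Function.Injective (fun (a : ℤ) (_ : Fin 1) => a) := fun a b h => congrFun h 0
  rw [IsRootOf, Fin.forall_fin_two]
  simp only [pairSupport, Fin.cons_zero, Fin.cons_one]
  rw [Finset.sum_pair h01, Finset.sum_image hinj.injOn]
  simp [chEval]

theorem sum_mul_pow_eq {A1 : Finset ℤ} {m M : ℤ} (hm : ∀ a ∈ A1, m ≤ a)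
    (hM : ∀ a ∈ A1, a ≤ M) (u : ℤ → ℂ) (s : ℂ) {x : ℂ} (hx : x ≠ 0) :
    ∑ a ∈ A1, u a * (s * x) ^ (a - m).toNat * s ^ (M - a).toNat =
      s ^ (M - m).toNat * x ^ (-m) * ∑ a ∈ A1, u a * x ^ a := by
  rw [Finset.mul_sum]
  refine Finset.sum_congr rfl fun a ha => ?_
  have h1 : (M - m).toNat = (a - m).toNat + (M - a).toNat := by
    have := hm a ha
    have := hM a ha
    omega
  have h2 : x ^ (a - m).toNat = x ^ (-m) * x ^ a := by
    rw [← zpow_natCast, Int.toNat_of_nonneg (by linarith [hm a ha]), ← zpow_add₀ hx]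
    congr 1
    ring
  rw [h1, mul_pow, pow_add, h2]
  ring

/-- The Sylvester form of the resultant of `c_0 + c_1 t` and `∑ u_a t ^ a`. -/
def linearResultantValue (A1 : Finset ℤ) (m M : ℤ) (c : Fin 2 → (Fin 1 → ℤ) → ℂ) : ℂ :=
  ∑ a ∈ A1, c 1 (fun _ => a) * (-c 0 (fun _ => 0)) ^ (a - m).toNat *
    c 0 (fun _ => 1) ^ (M - a).toNat

theorem linearResultantValue_eq_zero_of_hasRoot {A1 : Finset ℤ} {m M : ℤ}
    (hm : ∀ a ∈ A1, m ≤ a) (hM : ∀ a ∈ A1, a ≤ M) {c : Fin 2 → (Fin 1 → ℤ) → ℂ}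
    (hc : HasRoot (n := 1) (pairSupport A1) c) : linearResultantValue A1 m M c = 0 := by
  obtain ⟨ξ, hξ⟩ := hc
  obtain ⟨h0, h1⟩ := isRootOf_pairSupport.1 hξ
  have h2 : -c 0 (fun _ => 0) = c 0 (fun _ => 1) * (ξ 0 : ℂ) := by linear_combination -h0
  rw [linearResultantValue, h2,
    sum_mul_pow_eq hm hM (fun a => c 1 (fun _ => a)) _ (ξ 0).ne_zero, h1, mul_zero]

theorem hasRoot_of_linearResultantValue_eq_zero {A1 : Finset ℤ} {m M : ℤ}
    (hm : ∀ a ∈ A1, m ≤ a) (hM : ∀ a ∈ A1, a ≤ M) {c : Fin 2 → (Fin 1 → ℤ) → ℂ}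
    (h0 : c 0 (fun _ => 0) ≠ 0) (h1 : c 0 (fun _ => 1) ≠ 0)
    (hc : linearResultantValue A1 m M c = 0) : HasRoot (n := 1) (pairSupport A1) c := by
  have hx : -c 0 (fun _ => 0) / c 0 (fun _ => 1) ≠ 0 := div_ne_zero (neg_ne_zero.2 h0) h1
  have hsx : -c 0 (fun _ => 0) =
      c 0 (fun _ => 1) * (-c 0 (fun _ => 0) / c 0 (fun _ => 1)) := by field_simp
  refine ⟨fun _ => Units.mk0 _ hx, isRootOf_pairSupport.2 ⟨?_, ?_⟩⟩
  · rw [Units.val_mk0, ← hsx, add_neg_cancel]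
  · rw [linearResultantValue, hsx,
      sum_mul_pow_eq hm hM (fun a => c 1 (fun _ => a)) _ hx] at hc
    exact (mul_eq_zero.1 hc).resolve_left
      (mul_ne_zero (pow_ne_zero _ h1) (zpow_ne_zero _ hx))

theorem exists_ne_zero_sum_zpow_eq_zero {A1 : Finset ℤ} {m M : ℤ} (hmA : m ∈ A1)
    (hMA : M ∈ A1) (hm : ∀ a ∈ A1, m ≤ a) (hmM : m < M) (u : ℤ → ℂ)
    (hum : u m ≠ 0) (huM : u M ≠ 0) : ∃ x : ℂ, x ≠ 0 ∧ ∑ a ∈ A1, u a * x ^ a = 0 := by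
  set q : Polynomial ℂ := ∑ a ∈ A1, Polynomial.C (u a) * Polynomial.X ^ (a - m).toNat with hq
  have hcoeff : ∀ b ∈ A1, q.coeff (b - m).toNat = u b := by
    intro b hb
    rw [hq, Polynomial.finsetSum_coeff, Finset.sum_eq_single_of_mem b hb]
    · simp
    · intro a ha hab
      rw [Polynomial.coeff_C_mul_X_pow, if_neg]
      have := hm a ha
      have := hm b hb
      omega
  have hdeg : q.degree ≠ 0 := by
    intro h
    have := Polynomial.coeff_eq_zero_of_degree_lt (p := q) (n := (M - m).toNat) (by
      rw [h]
      exact_mod_cast (by omega : 0 < (M - m).toNat))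
    rw [hcoeff M hMA] at this
    exact huM this
  obtain ⟨x, hx⟩ := IsAlgClosed.exists_root q hdeg
  have hx0 : x ≠ 0 := by
    rintro rfl
    have h0 := hcoeff m hmA
    rw [sub_self, Int.toNat_zero, Polynomial.coeff_zero_eq_eval_zero, hx.eq_zero] at h0
    exact hum h0.symm
  refine ⟨x, hx0, ?_⟩
  have h := hx.eq_zero
  rw [hq, Polynomial.eval_finsetSum] at h
  calc ∑ a ∈ A1, u a * x ^ a = x ^ m * ∑ a ∈ A1, u a * x ^ (a - m).toNat := by
        rw [Finset.mul_sum]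
        refine Finset.sum_congr rfl fun a ha => ?_
        rw [← zpow_natCast, Int.toNat_of_nonneg (by linarith [hm a ha]), zpow_sub₀ hx0]
        field_simp
    _ = 0 := by
        rw [← mul_zero (x ^ m), ← h]
        simp

open Filter Topology in
theorem mem_closure_hasRoot {A1 : Finset ℤ} {m M : ℤ} (hmA : m ∈ A1) (hMA : M ∈ A1)
    (hm : ∀ a ∈ A1, m ≤ a) (hM : ∀ a ∈ A1, a ≤ M) {c : Fin 2 → (Fin 1 → ℤ) → ℂ}
    (hc : linearResultantValue A1 m M c = 0) :
    c ∈ closure {c | HasRoot (n := 1) (pairSupport A1) c} := by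
  have hne : ∀ z : ℂ, ∀ᶠ ε : ℂ in 𝓝[≠] 0, z + ε ≠ 0 := by
    intro z
    by_cases hz : z = 0
    · filter_upwards [self_mem_nhdsWithin] with ε hε
      simpa [hz] using hε
    · have : ContinuousAt (fun ε : ℂ => z + ε) 0 := by fun_prop
      exact (this.eventually_ne (by simpa using hz)).filter_mono nhdsWithin_le_nhds
  by_cases hb : ∃ b ∈ A1, (-c 0 (fun _ => 0)) ^ (b - m).toNat *
      c 0 (fun _ => 1) ^ (M - b).toNat ≠ 0
  · obtain ⟨b, hbA, hb⟩ := hb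
    set w : ℤ → ℂ → ℂ := fun a ε => (-(c 0 (fun _ => 0) + ε)) ^ (a - m).toNat *
      (c 0 (fun _ => 1) + ε) ^ (M - a).toNat with hw
    have hwc : ∀ a, Continuous (w a) := fun a => by fun_prop
    have hwb : w b 0 ≠ 0 := by simpa [hw] using hb
    set g : ℂ → ℂ := fun ε => -(∑ a ∈ A1.erase b, c 1 (fun _ => a) * w a ε) / w b ε with hg
    have hg0 : g 0 = c 1 (fun _ => b) := by
      rw [linearResultantValue, ← Finset.add_sum_erase _ _ hbA] at hc
      rw [hg]
      simp only
      rw [div_eq_iff hwb]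
      simp only [hw, add_zero]
      simp only [mul_assoc] at hc
      linear_combination -hc
    have hgc : ContinuousAt g 0 :=
      ContinuousAt.div (by fun_prop) (hwc b).continuousAt hwb
    set γ : ℂ → Fin 2 → (Fin 1 → ℤ) → ℂ := fun ε i a =>
      if i = 0 then c 0 a + ε else if a = (fun _ => b) then g ε else c 1 a with hγ
    have hγ0 : γ 0 = c := by
      funext i a
      fin_cases i
      · simp [hγ]
      · by_cases ha : a = fun _ => b
        · simp [hγ, ha, hg0]
        · simp [hγ, ha]
    have hγc : ContinuousAt γ 0 := by
      refine continuousAt_pi.2 fun i => continuousAt_pi.2 fun a => ?_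
      simp only [hγ]
      split_ifs
      · fun_prop
      · exact hgc
      · exact continuousAt_const
    have hlim : Tendsto γ (𝓝[≠] 0) (𝓝 c) := by
      have h := hγc.tendsto.mono_left (nhdsWithin_le_nhds (s := {0}ᶜ))
      rwa [hγ0] at h
    refine mem_closure_of_tendsto hlim ?_
    filter_upwards [hne (c 0 (fun _ => 0)), hne (c 0 (fun _ => 1)),
      ((hwc b).continuousAt.eventually_ne hwb).filter_mono nhdsWithin_le_nhds] with ε h0 h1 h2
    refine hasRoot_of_linearResultantValue_eq_zero hm hM (by simpa [hγ] using h0)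
      (by simpa [hγ] using h1) ?_
    have hfun : ∀ a : ℤ, ((fun _ => a : Fin 1 → ℤ) = fun _ => b) ↔ a = b :=
      fun a => ⟨fun h => congrFun h 0, fun h => by rw [h]⟩
    have hterm : ∀ a, γ ε 1 (fun _ => a) * (-γ ε 0 (fun _ => 0)) ^ (a - m).toNat *
        γ ε 0 (fun _ => 1) ^ (M - a).toNat =
          (if a = b then g ε else c 1 (fun _ => a)) * w a ε := by
      intro a
      simp [hγ, hw, hfun, mul_assoc]
    rw [linearResultantValue, Finset.sum_congr rfl fun a _ => hterm a,
      ← Finset.add_sum_erase _ _ hbA, if_pos rfl]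
    rw [Finset.sum_congr rfl fun a ha => by rw [if_neg (Finset.ne_of_mem_erase ha)]]
    simp only [hg]
    rw [div_mul_cancel₀ _ h2, neg_add_cancel]
  · push Not at hb
    have h1 := hb m hmA
    have h0 := hb M hMA
    simp only [sub_self, Int.toNat_zero, pow_zero, one_mul, mul_one, pow_eq_zero_iff',
      neg_eq_zero] at h0 h1
    have hmM : m < M := by
      have := h0.2
      omega
    set γ : ℂ → Fin 2 → (Fin 1 → ℤ) → ℂ := fun ε i a =>
      if i = 0 then c 0 a else c 1 a + ε with hγ
    have hγ0 : γ 0 = c := by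
      funext i a
      fin_cases i <;> simp [hγ]
    have hγc : ContinuousAt γ 0 := by
      refine continuousAt_pi.2 fun i => continuousAt_pi.2 fun a => ?_
      simp only [hγ]
      split_ifs <;> fun_prop
    have hlim : Tendsto γ (𝓝[≠] 0) (𝓝 c) := by
      have h := hγc.tendsto.mono_left (nhdsWithin_le_nhds (s := {0}ᶜ))
      rwa [hγ0] at h
    refine mem_closure_of_tendsto hlim ?_
    filter_upwards [hne (c 1 (fun _ => m)), hne (c 1 (fun _ => M))] with ε hεm hεM
    obtain ⟨x, hx, hsum⟩ := exists_ne_zero_sum_zpow_eq_zero hmA hMA hm hmM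
      (fun a => c 1 (fun _ => a) + ε) hεm hεM
    refine ⟨fun _ => Units.mk0 x hx, isRootOf_pairSupport.2 ⟨?_, ?_⟩⟩
    · simp [hγ, h0.1, h1.1]
    · simpa [hγ] using hsum

theorem resultant_linear {A1 : Finset ℤ} {m M : ℤ} (hmA : m ∈ A1) (hMA : M ∈ A1)
    (hm : ∀ a ∈ A1, m ≤ a) (hM : ∀ a ∈ A1, a ≤ M) {R : MvPolynomial (Fin 2 × (Fin 1 → ℤ)) ℤ}
    (hR : IsResultant (n := 1) (pairSupport A1) R) :
    let P : MvPolynomial (Fin 2 × (Fin 1 → ℤ)) ℤ :=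
      ∑ a ∈ A1, MvPolynomial.X (1, fun _ => a) *
        (-MvPolynomial.X (0, fun _ => 0)) ^ (a - m).toNat *
          MvPolynomial.X (0, fun _ => 1) ^ (M - a).toNat
    R = P ∨ R = -P := by
  intro P
  set L : MvPolynomial (Fin 2 × (Fin 1 → ℤ)) ℤ :=
    (-MvPolynomial.X (0, fun _ => 0)) ^ (M - m).toNat with hLdef
  set Q : MvPolynomial (Fin 2 × (Fin 1 → ℤ)) ℤ :=
    ∑ a ∈ A1.erase M, MvPolynomial.X (1, fun _ => a) *
      (-MvPolynomial.X (0, fun _ => 0)) ^ (a - m).toNat *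
        MvPolynomial.X (0, fun _ => 1) ^ (M - a).toNat with hQdef
  have hfun : ∀ a b : ℤ, ((fun _ => a : Fin 1 → ℤ) = fun _ => b) ↔ a = b :=
    fun a b => ⟨fun h => congrFun h 0, fun h => by rw [h]⟩
  have hP : P = L * MvPolynomial.X (1, fun _ => M) + Q := by
    simp only [P]
    rw [← Finset.add_sum_erase _ _ hMA]
    simp [hLdef, hQdef, mul_comm]
  have heval : ∀ c, evalCoeff (n := 1) P c = linearResultantValue A1 m M c := by
    intro c
    simp only [evalCoeff, linearResultantValue, P, map_sum]
    simp
  have hX : ∀ i : Fin 2 × (Fin 1 → ℤ), i ≠ (1, fun _ => M) →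
      (MvPolynomial.X i : MvPolynomial (Fin 2 × (Fin 1 → ℤ)) ℤ) ∈
        MvPolynomial.supported ℤ ({(1, fun _ => M)}ᶜ : Set (Fin 2 × (Fin 1 → ℤ))) :=
    fun i hi => MvPolynomial.X_mem_supported.2 hi
  have hL : L ≠ 0 := pow_ne_zero _ (neg_ne_zero.2 (MvPolynomial.X_ne_zero _))
  have hLv : (1, fun _ => M) ∉ L.vars := by
    have : L ∈ MvPolynomial.supported ℤ ({(1, fun _ => M)}ᶜ : Set (Fin 2 × (Fin 1 → ℤ))) :=
      pow_mem (neg_mem (hX _ (by simp))) _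
    exact fun hv => MvPolynomial.mem_supported.1 this hv rfl
  have hQv : (1, fun _ => M) ∉ Q.vars := by
    have : Q ∈ MvPolynomial.supported ℤ ({(1, fun _ => M)}ᶜ : Set (Fin 2 × (Fin 1 → ℤ))) := by
      refine sum_mem fun a ha => mul_mem (mul_mem (hX _ ?_) (pow_mem (neg_mem (hX _ ?_)) _))
        (pow_mem (hX _ ?_) _)
      · simpa [hfun] using Finset.ne_of_mem_erase ha
      · simp
      · simp
    exact fun hv => MvPolynomial.mem_supported.1 this hv rfl
  have hLQ : IsRelPrime L Q := by
    rcases eq_or_ne m M with h | h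
    · rw [hLdef, h, sub_self, Int.toNat_zero, pow_zero]
      exact isRelPrime_one_left
    · refine IsRelPrime.pow_left ?_
      have hirr : Irreducible
          (-MvPolynomial.X (0, fun _ => 0) : MvPolynomial (Fin 2 × (Fin 1 → ℤ)) ℤ) :=
        MvPolynomial.X_prime.neg.irreducible
      rw [hirr.isRelPrime_iff_not_dvd]
      rintro ⟨G, hG⟩
      have := congrArg (MvPolynomial.aeval (fun p : Fin 2 × (Fin 1 → ℤ) =>
        if p = (0, fun _ => 0) then (0 : ℤ) else 1)) hG
      rw [hQdef, map_sum, Finset.sum_eq_single_of_mem m (Finset.mem_erase.2 ⟨h, hmA⟩)] at this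
      · simp [hfun] at this
      · intro a ha ham
        have : (a - m).toNat ≠ 0 := by
          have := hm a (Finset.mem_of_mem_erase ha)
          omega
        simp [this]
  rw [hP]
  refine IsResultant.eq_or_eq_neg (n := 1) (A := pairSupport A1) _ L Q hL hLv hQv hLQ ?_
    {c | c 0 (fun _ => 1) ≠ 0} ?_ ?_ ?_ hR
  · rw [← hP]
    simp only [heval]
    refine Set.Subset.antisymm (fun c hc => mem_closure_hasRoot hmA hMA hm hM hc) ?_
    refine closure_minimal (fun c hc => linearResultantValue_eq_zero_of_hasRoot hm hM hc) ?_
    refine isClosed_eq ?_ continuous_const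
    unfold linearResultantValue
    fun_prop
  · exact isOpen_ne_fun (by fun_prop) continuous_const
  · refine ⟨fun i a => if i = 0 then (if a = fun _ => 0 then -1 else 1) else 0, ?_, ?_⟩
    · simp [hfun]
    · exact ⟨fun _ => 1, isRootOf_pairSupport.2 (by simp [hfun])⟩
  · rintro c ⟨hc, ξ, hξ⟩
    have : Unique {ξ // IsRootOf (n := 1) (pairSupport A1) c ξ} := by
      refine ⟨⟨⟨ξ, hξ⟩⟩, fun η => Subtype.ext (funext fun i => Units.ext ?_)⟩
      have h1 := (isRootOf_pairSupport.1 hξ).1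
      have h2 := (isRootOf_pairSupport.1 η.2).1
      rw [Subsingleton.elim i 0]
      exact mul_left_cancel₀ hc (by linear_combination h2 - h1)
    exact Nat.card_unique

/-- **hidden variable, univariate case.**  Let `A_1 ⊆ ℤ` be a nonempty
finite subset and `F_1 = ∑_{a ∈ A_1} u_a t^a` the general univariate Laurent polynomial
with support `A_1`.
(a) Hiding the variable `t` among the coefficients, `F_1` becomes a Laurent polynomial
in zero variables with the single support `{0} ⊆ ℤ^0` and coefficient `F_1` itself;
the corresponding sparse resultant, evaluated at this coefficient, equals `± F_1`.
(b) `Res_{{0,1}, A_1}(z - t, F_1) = ± z^{-ord_t F_1} F_1(z)`, where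
`ord_t F_1 = min A_1`, as an identity in `ℚ[u][z]`. -/
theorem hidden_variable_univariate (A1 : Finset ℤ) (hA1 : A1.Nonempty) :
    -- (a) the hidden-variable resultant of a single univariate Laurent polynomial
    (∀ R0 : MvPolynomial (Fin 1 × (Fin 0 → ℤ)) ℤ,
      IsResultant (n := 0) (fun _ => {(0 : Fin 0 → ℤ)}) R0 →
      ∀ F1 : AddMonoidAlgebra (MvPolynomial {a // a ∈ A1} ℚ) ℤ,
        F1 = ∑ a ∈ A1.attach, AddMonoidAlgebra.single a.1 (MvPolynomial.X a) →
        MvPolynomial.aeval (fun _ => F1) R0 = F1 ∨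
        MvPolynomial.aeval (fun _ => F1) R0 = -F1) ∧
    -- (b) Res_{{0,1}, A_1}(z - t, F_1) = ± z^{-ord_t(F_1)} F_1(z)
    (∀ R : MvPolynomial (Fin 2 × (Fin 1 → ℤ)) ℤ,
      IsResultant (n := 1)
        (Fin.cons ({(fun _ => 0 : Fin 1 → ℤ), fun _ => 1} : Finset (Fin 1 → ℤ))
          (fun _ => A1.image (fun a => (fun _ : Fin 1 => a)))) R →
      MvPolynomial.aeval
          (fun p : Fin 2 × (Fin 1 → ℤ) =>
            if p.1 = 0 then
              (if p.2 = (fun _ => 0) then (Polynomial.X :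
                  Polynomial (MvPolynomial {a // a ∈ A1} ℚ))
               else if p.2 = (fun _ => 1) then -1 else 0)
            else
              (if h : p.2 0 ∈ A1 then
                Polynomial.C (MvPolynomial.X (⟨p.2 0, h⟩ : {a // a ∈ A1}))
               else 0)) R =
        (∑ a ∈ A1.attach, Polynomial.C (MvPolynomial.X a) *
          Polynomial.X ^ (a.1 - A1.min' hA1).toNat) ∨
      MvPolynomial.aeval
          (fun p : Fin 2 × (Fin 1 → ℤ) =>
            if p.1 = 0 then
              (if p.2 = (fun _ => 0) then (Polynomial.X :
                  Polynomial (MvPolynomial {a // a ∈ A1} ℚ))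
               else if p.2 = (fun _ => 1) then -1 else 0)
            else
              (if h : p.2 0 ∈ A1 then
                Polynomial.C (MvPolynomial.X (⟨p.2 0, h⟩ : {a // a ∈ A1}))
               else 0)) R =
        -(∑ a ∈ A1.attach, Polynomial.C (MvPolynomial.X a) *
          Polynomial.X ^ (a.1 - A1.min' hA1).toNat)) := by
  refine ⟨?_, ?_⟩
  · rintro R0 hR0 F1 -
    rcases resultant_zero_variables hR0 with rfl | rfl <;> simp
  · intro R hR
    set φ : Fin 2 × (Fin 1 → ℤ) → Polynomial (MvPolynomial {a // a ∈ A1} ℚ) := fun p =>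
      if p.1 = 0 then
        (if p.2 = (fun _ => 0) then Polynomial.X
         else if p.2 = (fun _ => 1) then -1 else 0)
      else
        (if h : p.2 0 ∈ A1 then
          Polynomial.C (MvPolynomial.X (⟨p.2 0, h⟩ : {a // a ∈ A1}))
         else 0) with hφ
    have hm : ∀ a ∈ A1, A1.min' hA1 ≤ a := fun a ha => A1.min'_le a ha
    have hM : ∀ a ∈ A1, a ≤ A1.max' hA1 := fun a ha => A1.le_max' a ha
    have h01 : (fun _ => 1 : Fin 1 → ℤ) ≠ fun _ => 0 := fun h => by
      simpa using congrFun h 0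
    have key : MvPolynomial.aeval φ (∑ a ∈ A1, MvPolynomial.X (1, fun _ => a) *
        (-MvPolynomial.X (0, fun _ => 0)) ^ (a - A1.min' hA1).toNat *
          MvPolynomial.X (0, fun _ => 1) ^ (A1.max' hA1 - a).toNat :
            MvPolynomial (Fin 2 × (Fin 1 → ℤ)) ℤ) =
        (-1) ^ (A1.max' hA1 - A1.min' hA1).toNat *
          ∑ a ∈ A1.attach, Polynomial.C (MvPolynomial.X a) *
            Polynomial.X ^ (a.1 - A1.min' hA1).toNat := by
      rw [map_sum, ← Finset.sum_attach, Finset.mul_sum]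
      refine Finset.sum_congr rfl fun a _ => ?_
      have h1 : (A1.max' hA1 - A1.min' hA1).toNat =
          (a.1 - A1.min' hA1).toNat + (A1.max' hA1 - a.1).toNat := by
        have := hm a.1 a.2
        have := hM a.1 a.2
        omega
      simp only [map_mul, map_pow, map_neg, MvPolynomial.aeval_X]
      simp only [hφ, h01, if_true, if_false, one_ne_zero, a.2, dite_true]
      rw [neg_pow (Polynomial.X : Polynomial (MvPolynomial {a // a ∈ A1} ℚ)), h1, pow_add]
      ring
    rcases resultant_linear (A1.min'_mem hA1) (A1.max'_mem hA1) hm hM hR with rfl | rfl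
    · rw [key]
      rcases neg_one_pow_eq_or (Polynomial (MvPolynomial {a // a ∈ A1} ℚ))
        (A1.max' hA1 - A1.min' hA1).toNat with h | h <;> simp [h]
    · rw [map_neg, key]
      rcases neg_one_pow_eq_or (Polynomial (MvPolynomial {a // a ∈ A1} ℚ))
        (A1.max' hA1 - A1.min' hA1).toNat with h | h <;> simp [h]

end
end
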